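/- There exists a constant C > 0, depending only on p, such that for every T > 0 the characteristic flux of the solution along the null hypersurface {t = x₁} is bounded by the data: ∫₀^T ∫_ℝ [ (x₂² + ½) |(∂_tφ + ∂₁φ)(t, t, x₂)|² + ½ |∂₂φ(t, t, x₂)|² + (1/(p+1)) |φ(t, t, x₂)|^{p+1} ] dx₂ dt ≤ C · E_{0,2}. -/

import Mathlib

noncomputable section

open MeasureTheory Real Set Filter Pointwise

/-- The Euclidean plane. -/
abbrev E2 : Type := EuclideanSpace ℝ (Fin 2)

/-- Time derivative `∂ₜφ`. -/
def pt (φ : ℝ → E2 → ℝ) (t : ℝ) (x : E2) : ℝ := deriv (fun s => φ s x) t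

/-- Second time derivative `∂ₜ²φ`. -/
def ptt (φ : ℝ → E2 → ℝ) (t : ℝ) (x : E2) : ℝ := deriv (fun s => pt φ s x) t

/-- Spatial partial derivative `∂ᵢ f` in the `i`-th coordinate direction. -/
def pdx (i : Fin 2) (f : E2 → ℝ) (x : E2) : ℝ := fderiv ℝ f x (EuclideanSpace.single i 1)

/-- Spatial Laplacian `Δf`. -/
def lap (f : E2 → ℝ) (x : E2) : ℝ := ∑ i : Fin 2, pdx i (pdx i f) x

/-- Squared norm of the spatial gradient `|∇f|²`. -/
def gradSq (f : E2 → ℝ) (x : E2) : ℝ := ∑ i : Fin 2, (pdx i f x) ^ 2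

/-- Squared norm of the spatial Hessian `|∇²f|²`. -/
def hessSq (f : E2 → ℝ) (x : E2) : ℝ := ∑ i : Fin 2, ∑ j : Fin 2, (pdx i (pdx j f) x) ^ 2

/-- `φ` solves the defocusing wave equation `∂ₜ²φ - Δφ = -|φ|^{p-1}φ` on all of `ℝ × ℝ²`. -/
def IsWaveSolR2 (p : ℝ) (φ : ℝ → E2 → ℝ) : Prop :=
  ∀ t : ℝ, ∀ x : E2, ptt φ t x - lap (φ t) x = -(|φ t x| ^ (p-1) * φ t x)

/-- Integrand of the weighted (conformal) energy `E_{0,2}` of the data `(φ₀, φ₁)`. -/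
def e02Integrand (p : ℝ) (φ₀ φ₁ : E2 → ℝ) (x : E2) : ℝ :=
  (1+‖x‖)^2 * (gradSq φ₀ x + (φ₁ x)^2) + (1+‖x‖)^2 * |φ₀ x| ^ (p+1)

/-- The weighted energy `E_{0,2}` on the whole plane. -/
def E02R (p : ℝ) (φ₀ φ₁ : E2 → ℝ) : ℝ := ∫ x : E2, e02Integrand p φ₀ φ₁ x

/-- The point `(a, b)` of the Euclidean plane. -/
def mkE (a b : ℝ) : E2 := EuclideanSpace.single 0 a + EuclideanSpace.single 1 b

/-- `f` is continuously differentiable in the coordinates `(t, s, z)`, with partial derivatives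
`ft`, `fs`, `fz`. -/
structure HasPartials (f ft fs fz : ℝ × ℝ × ℝ → ℝ) : Prop where
  cont : Continuous f
  cont_t : Continuous ft
  cont_s : Continuous fs
  cont_z : Continuous fz
  deriv_t : ∀ t s z, HasDerivAt (fun r => f (r, s, z)) (ft (t, s, z)) t
  deriv_s : ∀ t s z, HasDerivAt (fun r => f (t, r, z)) (fs (t, s, z)) s
  deriv_z : ∀ t s z, HasDerivAt (fun r => f (t, s, r)) (fz (t, s, z)) z

namespace HasPartials

variable {f ft fs fz g gt gs gz : ℝ × ℝ × ℝ → ℝ}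

theorem const (c : ℝ) : HasPartials (fun _ => c) (fun _ => 0) (fun _ => 0) (fun _ => 0) where
  cont := by fun_prop
  cont_t := by fun_prop
  cont_s := by fun_prop
  cont_z := by fun_prop
  deriv_t t s z := hasDerivAt_const _ _
  deriv_s t s z := hasDerivAt_const _ _
  deriv_z t s z := hasDerivAt_const _ _

theorem coord_t : HasPartials (fun q => q.1) (fun _ => 1) (fun _ => 0) (fun _ => 0) where
  cont := by fun_prop
  cont_t := by fun_prop
  cont_s := by fun_prop
  cont_z := by fun_prop
  deriv_t t s z := hasDerivAt_id _
  deriv_s t s z := hasDerivAt_const _ _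
  deriv_z t s z := hasDerivAt_const _ _

theorem coord_s : HasPartials (fun q => q.2.1) (fun _ => 0) (fun _ => 1) (fun _ => 0) where
  cont := by fun_prop
  cont_t := by fun_prop
  cont_s := by fun_prop
  cont_z := by fun_prop
  deriv_t t s z := hasDerivAt_const _ _
  deriv_s t s z := hasDerivAt_id _
  deriv_z t s z := hasDerivAt_const _ _

theorem coord_z : HasPartials (fun q => q.2.2) (fun _ => 0) (fun _ => 0) (fun _ => 1) where
  cont := by fun_prop
  cont_t := by fun_prop
  cont_s := by fun_prop
  cont_z := by fun_prop
  deriv_t t s z := hasDerivAt_const _ _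
  deriv_s t s z := hasDerivAt_const _ _
  deriv_z t s z := hasDerivAt_id _

theorem add (hf : HasPartials f ft fs fz) (hg : HasPartials g gt gs gz) :
    HasPartials (fun q => f q + g q) (fun q => ft q + gt q) (fun q => fs q + gs q)
      (fun q => fz q + gz q) where
  cont := hf.cont.add hg.cont
  cont_t := hf.cont_t.add hg.cont_t
  cont_s := hf.cont_s.add hg.cont_s
  cont_z := hf.cont_z.add hg.cont_z
  deriv_t t s z := (hf.deriv_t t s z).add (hg.deriv_t t s z)
  deriv_s t s z := (hf.deriv_s t s z).add (hg.deriv_s t s z)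
  deriv_z t s z := (hf.deriv_z t s z).add (hg.deriv_z t s z)

theorem sub (hf : HasPartials f ft fs fz) (hg : HasPartials g gt gs gz) :
    HasPartials (fun q => f q - g q) (fun q => ft q - gt q) (fun q => fs q - gs q)
      (fun q => fz q - gz q) where
  cont := hf.cont.sub hg.cont
  cont_t := hf.cont_t.sub hg.cont_t
  cont_s := hf.cont_s.sub hg.cont_s
  cont_z := hf.cont_z.sub hg.cont_z
  deriv_t t s z := (hf.deriv_t t s z).sub (hg.deriv_t t s z)
  deriv_s t s z := (hf.deriv_s t s z).sub (hg.deriv_s t s z)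
  deriv_z t s z := (hf.deriv_z t s z).sub (hg.deriv_z t s z)

theorem mul (hf : HasPartials f ft fs fz) (hg : HasPartials g gt gs gz) :
    HasPartials (fun q => f q * g q) (fun q => ft q * g q + f q * gt q)
      (fun q => fs q * g q + f q * gs q) (fun q => fz q * g q + f q * gz q) where
  cont := hf.cont.mul hg.cont
  cont_t := (hf.cont_t.mul hg.cont).add (hf.cont.mul hg.cont_t)
  cont_s := (hf.cont_s.mul hg.cont).add (hf.cont.mul hg.cont_s)
  cont_z := (hf.cont_z.mul hg.cont).add (hf.cont.mul hg.cont_z)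
  deriv_t t s z := (hf.deriv_t t s z).mul (hg.deriv_t t s z)
  deriv_s t s z := (hf.deriv_s t s z).mul (hg.deriv_s t s z)
  deriv_z t s z := (hf.deriv_z t s z).mul (hg.deriv_z t s z)

theorem congr {ft' fs' fz' : ℝ × ℝ × ℝ → ℝ} (hf : HasPartials f ft fs fz) (ht : ∀ q, ft q = ft' q)
    (hs : ∀ q, fs q = fs' q) (hz : ∀ q, fz q = fz' q) : HasPartials f ft' fs' fz' := by
  obtain rfl : ft = ft' := funext ht
  obtain rfl : fs = fs' := funext hs
  obtain rfl : fz = fz' := funext hz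
  exact hf

theorem comp {h h' : ℝ → ℝ} (hf : HasPartials f ft fs fz) (hc : Continuous fun q => h' (f q))
    (hd : ∀ q, HasDerivAt h (h' (f q)) (f q)) (hch : Continuous fun q => h (f q)) :
    HasPartials (fun q => h (f q)) (fun q => h' (f q) * ft q)
      (fun q => h' (f q) * fs q) (fun q => h' (f q) * fz q) where
  cont := hch
  cont_t := hc.mul hf.cont_t
  cont_s := hc.mul hf.cont_s
  cont_z := hc.mul hf.cont_z
  deriv_t t s z := (hd (t, s, z)).comp t (hf.deriv_t t s z)
  deriv_s t s z := (hd (t, s, z)).comp s (hf.deriv_s t s z)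
  deriv_z t s z := (hd (t, s, z)).comp z (hf.deriv_z t s z)

end HasPartials

/-- The half-square `[0, M] × [-M, M]`. -/
def box (M : ℝ) : Set (ℝ × ℝ) := Icc 0 M ×ˢ Icc (-M) M

theorem isCompact_box (M : ℝ) : IsCompact (box M) := isCompact_Icc.prod isCompact_Icc

theorem measurableSet_box (M : ℝ) : MeasurableSet (box M) := measurableSet_Icc.prod measurableSet_Icc

theorem Continuous.integrableOn_box {f : ℝ × ℝ → ℝ} (hf : Continuous f) (M : ℝ) :
    IntegrableOn f (box M) := hf.continuousOn.integrableOn_compact (isCompact_box M)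

theorem setIntegral_box_mono {f g : ℝ × ℝ → ℝ} (hf : Continuous f) (hg : Continuous g) {M : ℝ}
    (h : ∀ x ∈ box M, f x ≤ g x) : ∫ x in box M, f x ≤ ∫ x in box M, g x :=
  setIntegral_mono_on (hf.integrableOn_box M) (hg.integrableOn_box M) (measurableSet_box M) h

theorem setIntegral_box {f : ℝ × ℝ → ℝ} (hf : Continuous f) {M : ℝ} (hM : 0 ≤ M) :
    ∫ x in box M, f x = ∫ s in (0:ℝ)..M, ∫ z in (-M)..M, f (s, z) := by
  have h := hf.integrableOn_box M
  rw [box] at h ⊢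
  rw [Measure.volume_eq_prod] at h ⊢
  rw [setIntegral_prod _ h, intervalIntegral.integral_of_le hM, integral_Icc_eq_integral_Ioc]
  simp_rw [intervalIntegral.integral_of_le (show -M ≤ M by linarith), integral_Icc_eq_integral_Ioc]

theorem setIntegral_box_swap {f : ℝ × ℝ → ℝ} (hf : Continuous f) {M : ℝ} (hM : 0 ≤ M) :
    ∫ x in box M, f x = ∫ z in (-M)..M, ∫ s in (0:ℝ)..M, f (s, z) := by
  rw [setIntegral_box hf hM]
  refine intervalIntegral_intervalIntegral_swap (F := fun s z => f (s, z)) ?_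
  exact (hf.continuousOn.integrableOn_compact (isCompact_uIcc.prod isCompact_uIcc)).mono_set
    (prod_mono uIoc_subset_uIcc uIoc_subset_uIcc)

/-- Divergence theorem on the half-square for a field vanishing on three sides. -/
theorem setIntegral_box_divergence {g h g' h' : ℝ × ℝ → ℝ} {M : ℝ} (hM : 0 ≤ M)
    (hg' : Continuous g') (hh' : Continuous h')
    (hgd : ∀ s z, HasDerivAt (fun r => g (r, z)) (g' (s, z)) s)
    (hhd : ∀ s z, HasDerivAt (fun r => h (s, r)) (h' (s, z)) z)
    (hg0 : ∀ z, g (M, z) = 0) (hh0 : ∀ s, h (s, M) = 0) (hh1 : ∀ s, h (s, -M) = 0) :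
    ∫ x in box M, (g' x + h' x) = -∫ z in (-M)..M, g (0, z) := by
  rw [integral_add (hg'.integrableOn_box M) (hh'.integrableOn_box M), setIntegral_box_swap hg' hM,
    setIntegral_box hh' hM]
  have h1 : ∀ z, ∫ s in (0:ℝ)..M, g' (s, z) = -g (0, z) := fun z => by
    rw [intervalIntegral.integral_eq_sub_of_hasDerivAt (fun s _ => hgd s z)
      (Continuous.intervalIntegrable (by fun_prop) _ _), hg0]
    ring
  have h2 : ∀ s, ∫ z in (-M)..M, h' (s, z) = 0 := fun s => by
    rw [intervalIntegral.integral_eq_sub_of_hasDerivAt (fun z _ => hhd s z)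
      (Continuous.intervalIntegrable (by fun_prop) _ _), hh0, hh1]
    ring
  simp [h1, h2, intervalIntegral.integral_neg]

/-- Space-time divergence theorem over `[0, T] × box M`. -/
theorem integral_divergence_slab {P Pt Ps Pz Q Qt Qs Qz S St Ss Sz : ℝ × ℝ × ℝ → ℝ}
    (hP : HasPartials P Pt Ps Pz) (hQ : HasPartials Q Qt Qs Qz) (hS : HasPartials S St Ss Sz)
    {M T : ℝ} (hM : 0 ≤ M) (hT : 0 ≤ T) (hQ0 : ∀ t ∈ Icc 0 T, ∀ z, Q (t, M, z) = 0)
    (hS0 : ∀ t ∈ Icc 0 T, ∀ s, S (t, s, M) = 0) (hS1 : ∀ t ∈ Icc 0 T, ∀ s, S (t, s, -M) = 0) :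
    (∫ x in box M, P (T, x)) - (∫ x in box M, P (0, x))
        + ∫ t in (0:ℝ)..T, ∫ z in (-M)..M, Q (t, 0, z)
      = ∫ t in (0:ℝ)..T, ∫ x in box M, (Pt (t, x) - Qs (t, x) - Sz (t, x)) := by
  have cPt := hP.cont_t
  have cQs := hQ.cont_s
  have cSz := hS.cont_z
  have cQ := hQ.cont
  have cP := hP.cont
  have h1 : ∀ t ∈ uIcc 0 T, ∫ x in box M, (Pt (t, x) - Qs (t, x) - Sz (t, x))
      = (∫ x in box M, Pt (t, x)) + ∫ z in (-M)..M, Q (t, 0, z) := fun t ht => by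
    rw [uIcc_of_le hT] at ht
    have := setIntegral_box_divergence (g := fun x => Q (t, x)) (h := fun x => S (t, x))
      (g' := fun x => Qs (t, x)) (h' := fun x => Sz (t, x)) hM
      (by fun_prop) (by fun_prop) (hQ.deriv_s t) (hS.deriv_z t) (hQ0 t ht) (hS0 t ht) (hS1 t ht)
    have e : ∫ x in box M, (Pt (t, x) - Qs (t, x) - Sz (t, x))
        = (∫ x in box M, Pt (t, x)) - ∫ x in box M, (Qs (t, x) + Sz (t, x)) := by
      rw [← integral_sub (Continuous.integrableOn_box (by fun_prop) M)
        (Continuous.integrableOn_box (by fun_prop) M)]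
      simp_rw [sub_sub]
    rw [e, this]
    ring
  have c1 : Continuous fun t => ∫ x in box M, Pt (t, x) :=
    continuous_parametric_integral_of_continuous (f := fun t x => Pt (t, x))
      (by simpa [Function.uncurry_def] using cPt) (isCompact_box M)
  have c2 : Continuous fun t => ∫ z in (-M)..M, Q (t, 0, z) := by fun_prop
  rw [intervalIntegral.integral_congr h1,
    intervalIntegral.integral_add (c1.intervalIntegrable _ _) (c2.intervalIntegrable _ _),
    intervalIntegral_integral_swap (f := fun t x => Pt (t, x))]
  · have h2 : ∀ x, ∫ t in (0:ℝ)..T, Pt (t, x) = P (T, x) - P (0, x) := fun x =>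
      intervalIntegral.integral_eq_sub_of_hasDerivAt (fun t _ => hP.deriv_t t x.1 x.2)
        (Continuous.intervalIntegrable (by fun_prop) _ _)
    simp_rw [h2]
    rw [integral_sub (Continuous.integrableOn_box (by fun_prop) M)
      (Continuous.integrableOn_box (by fun_prop) M)]
  · rw [Measure.prod_restrict]
    exact (cPt.continuousOn.integrableOn_compact (isCompact_uIcc.prod (isCompact_box M))).mono_set
      (prod_mono uIoc_subset_uIcc le_rfl)

/-- Space-time divergence theorem for the current `(P, Q, S)` multiplied by a weight `ω` that
vanishes on the lateral sides. -/
theorem integral_weighted_divergence_slab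
    {ω ωt ωs ωz P Pt Ps Pz Q Qt Qs Qz S St Ss Sz : ℝ × ℝ × ℝ → ℝ}
    (hω : HasPartials ω ωt ωs ωz)
    (hP : HasPartials P Pt Ps Pz) (hQ : HasPartials Q Qt Qs Qz) (hS : HasPartials S St Ss Sz)
    {M T : ℝ} (hM : 0 ≤ M) (hT : 0 ≤ T) (hω0 : ∀ t ∈ Icc 0 T, ∀ z, ω (t, M, z) = 0)
    (hω1 : ∀ t ∈ Icc 0 T, ∀ s, ω (t, s, M) = 0) (hω2 : ∀ t ∈ Icc 0 T, ∀ s, ω (t, s, -M) = 0) :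
    (∫ x in box M, ω (T, x) * P (T, x)) - (∫ x in box M, ω (0, x) * P (0, x))
        + ∫ t in (0:ℝ)..T, ∫ z in (-M)..M, ω (t, 0, z) * Q (t, 0, z)
      = ∫ t in (0:ℝ)..T, ∫ x in box M, (ωt (t, x) * P (t, x) - ωs (t, x) * Q (t, x)
          - ωz (t, x) * S (t, x) + ω (t, x) * (Pt (t, x) - Qs (t, x) - Sz (t, x))) := by
  rw [integral_divergence_slab (hω.mul hP) (hω.mul hQ) (hω.mul hS) hM hT
    (fun t ht z => by simp [hω0 t ht]) (fun t ht z => by simp [hω1 t ht])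
    (fun t ht z => by simp [hω2 t ht])]
  refine intervalIntegral.integral_congr fun t _ =>
    setIntegral_congr_fun (measurableSet_box M) fun x _ => ?_
  ring

/-- The cutoff profile `max(0, 1 - y/Λ)²`. -/
def cutoff (Λ y : ℝ) : ℝ := max 0 (1 - y / Λ) ^ 2

/-- The derivative of `cutoff`. -/
def cutoffDeriv (Λ y : ℝ) : ℝ := -(2 / Λ) * max 0 (1 - y / Λ)

theorem hasDerivAt_max_zero_sq (y : ℝ) :
    HasDerivAt (fun y : ℝ => max 0 y ^ 2) (2 * max 0 y) y := by
  rcases lt_trichotomy y 0 with h | rfl | h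
  · rw [max_eq_left h.le, mul_zero]
    refine (hasDerivAt_const y (0:ℝ)).congr_of_eventuallyEq ?_
    filter_upwards [eventually_lt_nhds h] with x hx
    simp [max_eq_left hx.le]
  · have : (fun y : ℝ => max 0 y ^ 2) =O[nhds 0] fun x => ‖x - 0‖ ^ 2 := by
      refine Asymptotics.isBigO_of_le _ fun x => ?_
      rw [norm_pow, norm_pow, norm_norm, sub_zero]
      gcongr
      rw [Real.norm_eq_abs, Real.norm_eq_abs, abs_of_nonneg (le_max_left _ _)]
      exact max_le (abs_nonneg _) (le_abs_self _)
    have h := (this.hasFDerivAt (by norm_num)).hasDerivAt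
    simpa using h
  · rw [max_eq_right h.le]
    have h1 : HasDerivAt (fun y : ℝ => y ^ 2) (2 * y) y := by simpa using hasDerivAt_pow 2 y
    refine h1.congr_of_eventuallyEq ?_
    filter_upwards [eventually_gt_nhds h] with x hx
    simp [max_eq_right hx.le]

theorem hasDerivAt_cutoff (Λ y : ℝ) : HasDerivAt (cutoff Λ) (cutoffDeriv Λ y) y := by
  have h := (hasDerivAt_max_zero_sq (1 - y / Λ)).comp y
    (((hasDerivAt_id y).div_const Λ).const_sub 1)
  refine h.congr_deriv ?_
  simp only [cutoffDeriv]
  ring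

theorem continuous_cutoff (Λ : ℝ) : Continuous (cutoff Λ) := by unfold cutoff; fun_prop

theorem continuous_cutoffDeriv (Λ : ℝ) : Continuous (cutoffDeriv Λ) := by
  unfold cutoffDeriv; fun_prop

theorem cutoff_nonneg (Λ y : ℝ) : 0 ≤ cutoff Λ y := sq_nonneg _

theorem cutoff_le_one {Λ y : ℝ} (hΛ : 0 < Λ) (hy : 0 ≤ y) : cutoff Λ y ≤ 1 := by
  have h : max 0 (1 - y / Λ) ≤ 1 := max_le zero_le_one (by linarith [div_nonneg hy hΛ.le])
  exact pow_le_one₀ (le_max_left _ _) h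

theorem cutoff_eq_zero {Λ y : ℝ} (hΛ : 0 < Λ) (hy : Λ ≤ y) : cutoff Λ y = 0 := by
  have : 1 - y / Λ ≤ 0 := by linarith [(one_le_div hΛ).2 hy]
  simp [cutoff, max_eq_left this]

theorem cutoff_ge {Λ y c : ℝ} (hΛ : 0 < Λ) (hy : y ≤ c) (hc : c ≤ Λ) :
    (1 - c / Λ) ^ 2 ≤ cutoff Λ y := by
  have h0 : 0 ≤ 1 - c / Λ := by linarith [(div_le_one hΛ).2 hc]
  have h1 : y / Λ ≤ c / Λ := by gcongr
  exact pow_le_pow_left₀ h0 (le_max_of_le_right (by linarith)) 2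

theorem cutoff_ge_quarter {Λ y : ℝ} (hΛ : 0 < Λ) (hy : y ≤ Λ / 2) : 1 / 4 ≤ cutoff Λ y := by
  refine le_trans ?_ (cutoff_ge hΛ hy (by linarith))
  rw [div_div, mul_comm, ← div_div, div_self hΛ.ne']
  norm_num

theorem cutoffDeriv_nonpos {Λ : ℝ} (hΛ : 0 < Λ) (y : ℝ) : cutoffDeriv Λ y ≤ 0 := by
  have : 0 ≤ 2 / Λ * max 0 (1 - y / Λ) := by positivity
  unfold cutoffDeriv
  linarith

theorem neg_le_cutoffDeriv {Λ y : ℝ} (hΛ : 0 < Λ) (hy : 0 ≤ y) : -(2 / Λ) ≤ cutoffDeriv Λ y := by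
  have h : max 0 (1 - y / Λ) ≤ 1 := max_le zero_le_one (by linarith [div_nonneg hy hΛ.le])
  have : 2 / Λ * max 0 (1 - y / Λ) ≤ 2 / Λ * 1 := by gcongr
  unfold cutoffDeriv
  linarith

/-- The squared Japanese bracket `1 + s² + z²`. -/
def bracket (x : ℝ × ℝ) : ℝ := 1 + x.1 ^ 2 + x.2 ^ 2

theorem one_le_bracket (x : ℝ × ℝ) : 1 ≤ bracket x := by unfold bracket; nlinarith [sq_nonneg x.1, sq_nonneg x.2]

theorem bracket_pos (x : ℝ × ℝ) : 0 < bracket x := one_pos.trans_le (one_le_bracket x)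

@[fun_prop]
theorem continuous_bracket : Continuous bracket := by unfold bracket; fun_prop

theorem log_bracket_nonneg (x : ℝ × ℝ) : 0 ≤ log (bracket x) := log_nonneg (one_le_bracket x)

theorem le_log_bracket {Λ : ℝ} (hΛ : 0 ≤ Λ) {x : ℝ × ℝ} (hx : exp Λ ≤ |x.1| ∨ exp Λ ≤ |x.2|) :
    Λ ≤ log (bracket x) := by
  rw [le_log_iff_exp_le (bracket_pos x)]
  have h1 := one_le_exp hΛ
  unfold bracket
  rcases hx with h | h
  · nlinarith [sq_abs x.1, sq_nonneg x.2]
  · nlinarith [sq_abs x.2, sq_nonneg x.1]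

theorem bracket_le {M : ℝ} (hM : 1 ≤ M) {x : ℝ × ℝ} (hx : x ∈ box M) : bracket x ≤ 3 * M ^ 2 := by
  obtain ⟨⟨h1, h2⟩, h3, h4⟩ := hx
  unfold bracket
  nlinarith

theorem log_bracket_le {M : ℝ} (hM : 1 ≤ M) {x : ℝ × ℝ} (hx : x ∈ box M) :
    log (bracket x) ≤ log (3 * M ^ 2) := log_le_log (bracket_pos x) (bracket_le hM hx)

theorem hasPartials_bracket : HasPartials (fun q => bracket q.2) (fun _ => 0)
    (fun q => 2 * q.2.1) (fun q => 2 * q.2.2) := by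
  have h := ((HasPartials.const 1).add (HasPartials.coord_s.mul HasPartials.coord_s)).add
    (HasPartials.coord_z.mul HasPartials.coord_z)
  simp only [← sq] at h
  exact h.congr (fun q => by ring) (fun q => by ring) (fun q => by ring)

theorem hasPartials_cutoff (Λ k : ℝ) :
    HasPartials (fun q => cutoff Λ (log (bracket q.2) + k * q.1))
      (fun q => cutoffDeriv Λ (log (bracket q.2) + k * q.1) * k)
      (fun q => cutoffDeriv Λ (log (bracket q.2) + k * q.1) * (2 * q.2.1 / bracket q.2))
      (fun q => cutoffDeriv Λ (log (bracket q.2) + k * q.1) * (2 * q.2.2 / bracket q.2)) := by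
  have hb : ∀ q : ℝ × ℝ × ℝ, bracket q.2 ≠ 0 := fun q => (bracket_pos _).ne'
  have cb : Continuous fun q : ℝ × ℝ × ℝ => bracket q.2 := by fun_prop
  have hlog := (hasPartials_bracket.comp (h := log) (h' := fun y => y⁻¹) (cb.inv₀ hb)
    (fun q => hasDerivAt_log (hb q)) (cb.log hb)).add
      ((HasPartials.const k).mul HasPartials.coord_t)
  refine (hlog.comp (h := cutoff Λ) (h' := cutoffDeriv Λ)
    ((continuous_cutoffDeriv Λ).comp hlog.cont) (fun q => hasDerivAt_cutoff _ _)
    ((continuous_cutoff Λ).comp hlog.cont)).congr (fun q => ?_) (fun q => ?_) (fun q => ?_)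
  · ring
  · field_simp; ring
  · field_simp; ring

/-- The potential energy density `|y|^{p+1} / (p+1)`. -/
def pot (p y : ℝ) : ℝ := |y| ^ (p + 1) / (p + 1)

theorem hasDerivAt_pot {p : ℝ} (hp : 1 < p) (y : ℝ) :
    HasDerivAt (pot p) (|y| ^ (p - 1) * y) y := by
  have h := (hasDerivAt_abs_rpow y (p := p + 1) (by linarith)).div_const (p + 1)
  refine h.congr_deriv ?_
  have : p + 1 ≠ 0 := by linarith
  rw [show p + 1 - 2 = p - 1 by ring]
  field_simp

theorem continuous_pot {p : ℝ} (hp : 1 < p) : Continuous (pot p) :=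
  continuous_iff_continuousAt.2 fun y => (hasDerivAt_pot hp y).continuousAt

theorem pot_nonneg {p : ℝ} (hp : 1 < p) (y : ℝ) : 0 ≤ pot p y := by
  have : 0 < p + 1 := by linarith
  unfold pot
  positivity

theorem abs_rpow_mul_sq {p : ℝ} (hp : 1 < p) (y : ℝ) :
    |y| ^ (p - 1) * y * y = (p + 1) * pot p y := by
  have h : p + 1 ≠ 0 := by linarith
  rw [pot, mul_div_cancel₀ _ h, mul_assoc, ← abs_mul_abs_self, ← sq,
    show p + 1 = p - 1 + (2 : ℕ) by push_cast; ring, rpow_add_natCast' (abs_nonneg y) (by push_cast; linarith)]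

/-- A solution of the wave equation in the null coordinates `(t, s, z) = (t, x₁ - t, x₂)`:
`f` is the solution, `a`, `b`, `c` are its derivatives in the original coordinates `t`, `x₁`, `x₂`,
and the other functions are the second derivatives. -/
structure IsNullSol (p : ℝ) (f a b c att atx aty bxx bxy cyy : ℝ × ℝ × ℝ → ℝ) : Prop where
  hf : HasPartials f (fun q => a q + b q) b c
  ha : HasPartials a (fun q => att q + atx q) atx aty
  hb : HasPartials b (fun q => atx q + bxx q) bxx bxy
  hc : HasPartials c (fun q => aty q + bxy q) bxy cyy
  wave : ∀ q, att q - bxx q - cyy q = -(|f q| ^ (p - 1) * f q)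

/-- The energy density. -/
def energy (p : ℝ) (f a b c : ℝ × ℝ × ℝ → ℝ) (q : ℝ × ℝ × ℝ) : ℝ :=
  (a q ^ 2 + b q ^ 2 + c q ^ 2) / 2 + pot p (f q)

theorem energy_nonneg {p : ℝ} (hp : 1 < p) (f a b c : ℝ × ℝ × ℝ → ℝ) (q : ℝ × ℝ × ℝ) :
    0 ≤ energy p f a b c q := by
  have := pot_nonneg hp (f q)
  unfold energy
  positivity

namespace IsNullSol

variable {p : ℝ} {f a b c att atx aty bxx bxy cyy : ℝ × ℝ × ℝ → ℝ}

theorem hasPartials_pot (h : IsNullSol p f a b c att atx aty bxx bxy cyy) (hp : 1 < p) :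
    HasPartials (fun q => pot p (f q)) (fun q => |f q| ^ (p - 1) * f q * (a q + b q))
      (fun q => |f q| ^ (p - 1) * f q * b q) (fun q => |f q| ^ (p - 1) * f q * c q) := by
  have cf := h.hf.cont
  refine h.hf.comp (h' := fun y => |y| ^ (p - 1) * y) ?_ (fun q => hasDerivAt_pot hp _)
    ((continuous_pot hp).comp cf)
  exact (cf.abs.rpow_const fun q => Or.inr (by linarith)).mul cf

theorem hasPartials_energy (h : IsNullSol p f a b c att atx aty bxx bxy cyy) (hp : 1 < p) :
    HasPartials (energy p f a b c)
      (fun q => a q * (att q + atx q) + b q * (atx q + bxx q) + c q * (aty q + bxy q)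
        + |f q| ^ (p - 1) * f q * (a q + b q))
      (fun q => a q * atx q + b q * bxx q + c q * bxy q + |f q| ^ (p - 1) * f q * b q)
      (fun q => a q * aty q + b q * bxy q + c q * cyy q + |f q| ^ (p - 1) * f q * c q) := by
  have h1 := ((HasPartials.const (1 / 2)).mul (((h.ha.mul h.ha).add (h.hb.mul h.hb)).add
    (h.hc.mul h.hc))).add (h.hasPartials_pot hp)
  have e : energy p f a b c = fun q => 1 / 2 * (a q * a q + b q * b q + c q * c q) + pot p (f q) := by
    funext q
    unfold energy
    ring
  rw [e]
  exact h1.congr (fun q => by ring) (fun q => by ring) (fun q => by ring)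

theorem continuous_energy (h : IsNullSol p f a b c att atx aty bxx bxy cyy) (hp : 1 < p) :
    Continuous (energy p f a b c) := (h.hasPartials_energy hp).cont

theorem setIntegral_cutoff_energy_le (h : IsNullSol p f a b c att atx aty bxx bxy cyy) (hp : 1 < p)
    {Λ T : ℝ} (hΛ : 0 < Λ) (hT : 0 ≤ T) :
    ∫ x in box (exp Λ), bracket x * energy p f a b c (T, x) * cutoff Λ (log (bracket x) + 3 * T)
      ≤ exp (3 * T) * ∫ x in box (exp Λ), bracket x * energy p f a b c (0, x) := by
  have ce := h.continuous_energy hp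
  have he : HasPartials (fun q : ℝ × ℝ × ℝ => exp (-3 * q.1)) (fun q => -3 * exp (-3 * q.1))
      (fun _ => 0) (fun _ => 0) :=
    (((HasPartials.const (-3)).mul HasPartials.coord_t).comp (h := exp) (h' := exp) (by fun_prop)
      (fun q => hasDerivAt_exp _) (by fun_prop)).congr
      (fun q => by ring) (fun q => by ring) (fun q => by ring)
  have hω := (hasPartials_bracket.mul he).mul (hasPartials_cutoff Λ 3)
  have hE := h.hasPartials_energy hp
  have hs : ∀ t ∈ Icc 0 T, ∀ x : ℝ × ℝ, (exp Λ ≤ |x.1| ∨ exp Λ ≤ |x.2|) →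
      bracket x * exp (-3 * t) * cutoff Λ (log (bracket x) + 3 * t) = 0 := fun t ht x hx => by
    rw [cutoff_eq_zero hΛ (by linarith [ht.1, le_log_bracket hΛ.le hx]), mul_zero]
  have key := integral_weighted_divergence_slab hω hE (hE.add (h.ha.mul h.hb)) (h.ha.mul h.hc)
    (exp_pos Λ).le hT
    (fun t ht z => hs t ht (_, _) (Or.inl (le_abs_self _)))
    (fun t ht s => hs t ht (_, _) (Or.inr (le_abs_self _)))
    (fun t ht s => hs t ht (_, _) (Or.inr (by rw [abs_neg]; exact le_abs_self _)))
  have hab : ∀ q, |a q * b q| ≤ energy p f a b c q := fun q => by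
    have := pot_nonneg hp (f q)
    rw [abs_le]
    unfold energy
    constructor <;> nlinarith [sq_nonneg (a q + b q), sq_nonneg (a q - b q), sq_nonneg (c q)]
  have hac : ∀ q, |a q * c q| ≤ energy p f a b c q := fun q => by
    have := pot_nonneg hp (f q)
    rw [abs_le]
    unfold energy
    constructor <;> nlinarith [sq_nonneg (a q + c q), sq_nonneg (a q - c q), sq_nonneg (b q)]
  have hflux : 0 ≤ ∫ t in (0:ℝ)..T, ∫ z in (-exp Λ)..exp Λ,
      bracket (0, z) * exp (-3 * t) * cutoff Λ (log (bracket (0, z)) + 3 * t)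
        * (energy p f a b c (t, 0, z) + a (t, 0, z) * b (t, 0, z)) := by
    refine intervalIntegral.integral_nonneg hT fun t _ =>
      intervalIntegral.integral_nonneg (by linarith [exp_pos Λ]) fun z _ => ?_
    have h1 := (bracket_pos (0, z)).le
    have h2 := cutoff_nonneg Λ (log (bracket (0, z)) + 3 * t)
    have h3 := (abs_le.1 (hab (t, 0, z))).1
    have h4 := (exp_pos (-3 * t)).le
    exact mul_nonneg (mul_nonneg (mul_nonneg h1 h4) h2) (by linarith)
  have hbulk : ∀ t ∈ Icc 0 T, ∀ x : ℝ × ℝ, 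
      ((0 * exp (-3 * t) + bracket x * (-3 * exp (-3 * t))) * cutoff Λ (log (bracket x) + 3 * t)
        + bracket x * exp (-3 * t) * (cutoffDeriv Λ (log (bracket x) + 3 * t) * 3))
          * energy p f a b c (t, x)
      - ((2 * x.1 * exp (-3 * t) + bracket x * 0) * cutoff Λ (log (bracket x) + 3 * t)
        + bracket x * exp (-3 * t) * (cutoffDeriv Λ (log (bracket x) + 3 * t) * (2 * x.1 / bracket x)))
          * (energy p f a b c (t, x) + a (t, x) * b (t, x))
      - ((2 * x.2 * exp (-3 * t) + bracket x * 0) * cutoff Λ (log (bracket x) + 3 * t)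
        + bracket x * exp (-3 * t) * (cutoffDeriv Λ (log (bracket x) + 3 * t) * (2 * x.2 / bracket x)))
          * (a (t, x) * c (t, x)) ≤ 0 := by
    intro t ht x
    have h1 := bracket_pos x
    have h2 := cutoff_nonneg Λ (log (bracket x) + 3 * t)
    have h3 := cutoffDeriv_nonpos hΛ (log (bracket x) + 3 * t)
    have h4 := exp_pos (-3 * t)
    have h5 := hab (t, x)
    have h6 := hac (t, x)
    have h7 := energy_nonneg hp f a b c (t, x)
    have h8 : bracket x = 1 + x.1 ^ 2 + x.2 ^ 2 := rfl
    generalize cutoff Λ (log (bracket x) + 3 * t) = ψ at *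
    generalize cutoffDeriv Λ (log (bracket x) + 3 * t) = ψ' at *
    generalize energy p f a b c (t, x) = e at *
    generalize a (t, x) * b (t, x) = ab at *
    generalize a (t, x) * c (t, x) = ac at *
    generalize exp (-3 * t) = E at *
    generalize bracket x = N at *
    have hX : |2 * x.1 * (e + ab)| ≤ 2 * (N * e) := by
      rw [abs_mul]
      have i1 : |2 * x.1| ≤ N := by
        rw [abs_le]; constructor <;> nlinarith [sq_nonneg (x.1 + 1), sq_nonneg (x.1 - 1), sq_nonneg x.2]
      have i2 : |e + ab| ≤ 2 * e := (abs_add_le _ _).trans (by rw [abs_of_nonneg h7]; linarith)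
      calc |2 * x.1| * |e + ab| ≤ N * (2 * e) := by gcongr
        _ = _ := by ring
    have hZ : |2 * x.2 * ac| ≤ N * e := by
      rw [abs_mul]
      have i1 : |2 * x.2| ≤ N := by
        rw [abs_le]; constructor <;> nlinarith [sq_nonneg (x.2 + 1), sq_nonneg (x.2 - 1), sq_nonneg x.1]
      gcongr
    have hX' := abs_le.1 hX
    have hZ' := abs_le.1 hZ
    have e1 : ∀ y : ℝ, N * E * (ψ' * (y / N)) = E * ψ' * y := fun y => by field_simp
    rw [e1, e1]
    have k1 : 0 ≤ E * ψ * (3 * (N * e) + 2 * x.1 * (e + ab) + 2 * x.2 * ac) :=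
      mul_nonneg (mul_nonneg h4.le h2) (by linarith)
    have k2 : 0 ≤ E * (-ψ') * (3 * (N * e) - 2 * x.1 * (e + ab) - 2 * x.2 * ac) :=
      mul_nonneg (mul_nonneg h4.le (by linarith)) (by linarith)
    linarith
  have hle := intervalIntegral.integral_nonneg (μ := volume) hT (f := fun t => -∫ x in box (exp Λ), _)
    fun t ht => neg_nonneg.2 <| setIntegral_nonpos (measurableSet_box (exp Λ)) fun x _ => hbulk t ht x
  rw [intervalIntegral.integral_neg] at hle
  have e0 : ∀ t, ∀ x : ℝ × ℝ, a (t, x) * (att (t, x) + atx (t, x)) + b (t, x) * (atx (t, x) + bxx (t, x))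
      + c (t, x) * (aty (t, x) + bxy (t, x)) + |f (t, x)| ^ (p - 1) * f (t, x) * (a (t, x) + b (t, x))
      - (a (t, x) * atx (t, x) + b (t, x) * bxx (t, x) + c (t, x) * bxy (t, x)
        + |f (t, x)| ^ (p - 1) * f (t, x) * b (t, x) + (atx (t, x) * b (t, x) + a (t, x) * bxx (t, x)))
      - (aty (t, x) * c (t, x) + a (t, x) * cyy (t, x)) = 0 := fun t x => by
    linear_combination a (t, x) * h.wave (t, x)
  simp only [e0, mul_zero, add_zero] at key hle
  have hle1 : ∫ x in box (exp Λ), bracket x * exp (-3 * T) * cutoff Λ (log (bracket x) + 3 * T)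
        * energy p f a b c (T, x)
      ≤ ∫ x in box (exp Λ), bracket x * exp 0 * cutoff Λ (log (bracket x))
        * energy p f a b c (0, x) := by
    linarith
  have hle2 : ∫ x in box (exp Λ), bracket x * exp 0 * cutoff Λ (log (bracket x))
        * energy p f a b c (0, x) ≤ ∫ x in box (exp Λ), bracket x * energy p f a b c (0, x) := by
    have cc : Continuous fun x : ℝ × ℝ => cutoff Λ (log (bracket x)) :=
      (continuous_cutoff Λ).comp (continuous_bracket.log fun x => (bracket_pos x).ne')
    refine setIntegral_box_mono (by fun_prop) (by fun_prop) fun x _ => ?_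
    have h1 := cutoff_le_one hΛ (log_bracket_nonneg x)
    have h2 := mul_nonneg (bracket_pos x).le (energy_nonneg hp f a b c (0, x))
    rw [exp_zero]
    nlinarith
  have e3 : ∫ x in box (exp Λ), bracket x * exp (-3 * T) * cutoff Λ (log (bracket x) + 3 * T)
        * energy p f a b c (T, x) = exp (-3 * T) * ∫ x in box (exp Λ),
          bracket x * energy p f a b c (T, x) * cutoff Λ (log (bracket x) + 3 * T) := by
    rw [← integral_const_mul]
    congr! 2
    ring
  have e4 : exp (3 * T) * exp (-3 * T) = 1 := by rw [← exp_add]; simp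
  have := mul_le_mul_of_nonneg_left (e3 ▸ hle1.trans hle2) (exp_pos (3 * T)).le
  rwa [← mul_assoc, e4, one_mul] at this

end IsNullSol

theorem box_subset_box {M M' : ℝ} (h : M ≤ M') : box M ⊆ box M' :=
  prod_mono (Icc_subset_Icc le_rfl h) (Icc_subset_Icc (neg_le_neg h) h)

theorem setIntegral_box_le_of_subset {f : ℝ × ℝ → ℝ} (hf : Continuous f) (h0 : ∀ x, 0 ≤ f x)
    {M M' : ℝ} (h : M ≤ M') : ∫ x in box M, f x ≤ ∫ x in box M', f x :=
  setIntegral_mono_set (hf.integrableOn_box M') (ae_of_all _ h0) (box_subset_box h).eventuallyLE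

theorem HasPartials.setIntegral_box_divergence {G Gt Gs Gz H Ht Hs Hz : ℝ × ℝ × ℝ → ℝ}
    (hG : HasPartials G Gt Gs Gz) (hH : HasPartials H Ht Hs Hz) {M : ℝ} (hM : 0 ≤ M) (t : ℝ)
    (hG0 : ∀ z, G (t, M, z) = 0) (hH0 : ∀ s, H (t, s, M) = 0) (hH1 : ∀ s, H (t, s, -M) = 0) :
    ∫ x in box M, (Gs (t, x) + Hz (t, x)) = -∫ z in (-M)..M, G (t, 0, z) := by
  have cs := hG.cont_s
  have cz := hH.cont_z
  exact _root_.setIntegral_box_divergence (g := fun x => G (t, x)) (h := fun x => H (t, x))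
    (g' := fun x => Gs (t, x)) (h' := fun x => Hz (t, x)) hM (by fun_prop) (by fun_prop)
    (hG.deriv_s t) (hH.deriv_z t) hG0 hH0 hH1

theorem exists_setIntegral_box_rpow_le :
    ∃ c, 0 ≤ c ∧ ∀ M, ∫ x in box M, bracket x ^ (-(5 / 4) : ℝ) ≤ c := by
  have hi : Integrable (fun x : ℝ × ℝ => (1 + ‖x‖ ^ 2) ^ (-(5 / 2) / 2 : ℝ)) :=
    integrable_rpow_neg_one_add_norm_sq (by simp; norm_num)
  have hb : ∀ x : ℝ × ℝ, bracket x ^ (-(5 / 4) : ℝ) ≤ (1 + ‖x‖ ^ 2) ^ (-(5 / 2) / 2 : ℝ) := fun x => by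
    rw [show (-(5 / 2) / 2 : ℝ) = -(5 / 4) by norm_num]
    refine rpow_le_rpow_of_nonpos (by positivity) ?_ (by norm_num)
    rw [Prod.norm_def, bracket, Real.norm_eq_abs, Real.norm_eq_abs]
    rcases max_choice |x.1| |x.2| with h | h <;> rw [h, sq_abs] <;> nlinarith [sq_nonneg x.1, sq_nonneg x.2]
  refine ⟨∫ x : ℝ × ℝ, (1 + ‖x‖ ^ 2) ^ (-(5 / 2) / 2 : ℝ),
    integral_nonneg fun x => by positivity, fun M => ?_⟩
  · have cb : Continuous fun x : ℝ × ℝ => bracket x ^ (-(5 / 4) : ℝ) :=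
      continuous_bracket.rpow_const fun x => Or.inl (bracket_pos x).ne'
    exact (setIntegral_mono (cb.integrableOn_box M) hi.integrableOn hb).trans
      (setIntegral_le_integral hi (ae_of_all _ fun x => by positivity))

theorem sq_mul_rpow_le {p : ℝ} (hp1 : 1 < p) (hp5 : p < 5) {y N : ℝ} (hy : 0 ≤ y) (hN : 1 ≤ N) :
    y ^ 2 * N ^ (-(1 / 2) : ℝ) ≤ N * y ^ (p + 1) + N ^ (-(5 / 4) : ℝ) := by
  have hN0 : 0 < N := one_pos.trans_le hN
  rcases le_total (N ^ (-(3 / 2) : ℝ)) (y ^ (p - 1)) with h | h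
  · have e1 : y ^ (p + 1) = y ^ (p - 1) * y ^ 2 := by
      rw [show p + 1 = p - 1 + (2 : ℕ) by push_cast; ring,
        rpow_add_natCast' hy (by push_cast; linarith)]
    have e2 : N * N ^ (-(3 / 2) : ℝ) = N ^ (-(1 / 2) : ℝ) := by
      rw [← rpow_one_add' hN0.le (by norm_num)]
      norm_num
    have h2 : N ^ (-(1 / 2) : ℝ) ≤ N * y ^ (p - 1) := by rw [← e2]; gcongr
    have h3 : 0 ≤ N ^ (-(5 / 4) : ℝ) := by positivity
    calc y ^ 2 * N ^ (-(1 / 2) : ℝ) ≤ y ^ 2 * (N * y ^ (p - 1)) := by gcongr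
      _ ≤ _ := by rw [e1]; linarith
  · have h1 : y ^ 2 ≤ N ^ (-(3 / 4) : ℝ) := by
      have hq : 0 ≤ 2 / (p - 1) := by apply div_nonneg <;> linarith
      have h2 := rpow_le_rpow (by positivity) h hq
      rw [← rpow_mul hy, ← rpow_mul hN0.le, mul_div_cancel₀ _ (by linarith), rpow_two] at h2
      refine h2.trans (rpow_le_rpow_of_exponent_le hN ?_)
      rw [mul_div_assoc', div_le_iff₀ (by linarith)]
      linarith
    have e2 : N ^ (-(3 / 4) : ℝ) * N ^ (-(1 / 2) : ℝ) = N ^ (-(5 / 4) : ℝ) := by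
      rw [← rpow_add hN0]; norm_num
    have h3 : 0 ≤ N * y ^ (p + 1) := by positivity
    calc y ^ 2 * N ^ (-(1 / 2) : ℝ) ≤ N ^ (-(3 / 4) : ℝ) * N ^ (-(1 / 2) : ℝ) := by gcongr
      _ ≤ _ := by rw [e2]; linarith

theorem hasPartials_sqrt_weight {δ : ℝ} (hδ : 0 ≤ δ) :
    HasPartials (fun q => (√(1 + δ * bracket q.2))⁻¹) (fun _ => 0)
      (fun q => -(δ * q.2.1 / √(1 + δ * bracket q.2) ^ 3))
      (fun q => -(δ * q.2.2 / √(1 + δ * bracket q.2) ^ 3)) := by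
  have hb : ∀ q : ℝ × ℝ × ℝ, 0 < 1 + δ * bracket q.2 := fun q => by
    have := bracket_pos q.2
    positivity
  have hr : ∀ q : ℝ × ℝ × ℝ, √(1 + δ * bracket q.2) ≠ 0 := fun q => (sqrt_pos.2 (hb q)).ne'
  have cr : Continuous fun q : ℝ × ℝ × ℝ => √(1 + δ * bracket q.2) := by fun_prop
  have h1 := ((HasPartials.const 1).add ((HasPartials.const δ).mul hasPartials_bracket)).comp
    (h := fun y => (√y)⁻¹) (h' := fun y => -(1 / (2 * √y)) / √y ^ 2)
    (((continuous_const.div (cr.const_mul 2) fun q => mul_ne_zero two_ne_zero (hr q)).neg).div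
      (cr.pow 2) fun q => pow_ne_zero 2 (hr q))
    (fun q => ((hasDerivAt_sqrt (hb q).ne').inv (hr q))) (cr.inv₀ hr)
  refine h1.congr (fun q => by ring) (fun q => ?_) (fun q => ?_)
  · have := hr q
    field_simp
    ring
  · have := hr q
    field_simp
    ring

/-- The divergence of `w x`, for the weight `w = θ f² / r`, `r² = 1 + δ ⟨x⟩²`. -/
def hardyDensity (δ Λ : ℝ) (f b c : ℝ × ℝ → ℝ) (x : ℝ × ℝ) : ℝ :=
  (√(1 + δ * bracket x))⁻¹ * cutoff Λ (log (bracket x)) * (2 * f x ^ 2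
    + 2 * f x * (x.1 * b x + x.2 * c x))
  - δ * (x.1 ^ 2 + x.2 ^ 2) / √(1 + δ * bracket x) ^ 3 * cutoff Λ (log (bracket x)) * f x ^ 2
  + (√(1 + δ * bracket x))⁻¹ * cutoffDeriv Λ (log (bracket x))
    * (2 * (x.1 ^ 2 + x.2 ^ 2) / bracket x) * f x ^ 2

theorem setIntegral_hardyDensity {f ft b c : ℝ × ℝ × ℝ → ℝ} (hf : HasPartials f ft b c) (t : ℝ)
    {δ Λ : ℝ} (hδ : 0 < δ) (hΛ : 0 < Λ) :
    ∫ x in box (exp Λ), hardyDensity δ Λ (fun x => f (t, x)) (fun x => b (t, x))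
      (fun x => c (t, x)) x = 0 := by
  have hr : ∀ x, 0 < √(1 + δ * bracket x) := fun x => sqrt_pos.2 (by
    have := bracket_pos x
    positivity)
  have hζ := ((hasPartials_sqrt_weight hδ.le).mul (hasPartials_cutoff Λ 0)).mul (hf.mul hf)
  have hz : ∀ x : ℝ × ℝ, (exp Λ ≤ |x.1| ∨ exp Λ ≤ |x.2|) → ∀ A B C : ℝ,
      A * cutoff Λ (log (bracket x) + 0 * t) * B * C = 0 := fun x hx A B C => by
    rw [cutoff_eq_zero hΛ (by linarith [le_log_bracket hΛ.le hx])]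
    ring
  have key := (hζ.mul HasPartials.coord_s).setIntegral_box_divergence (hζ.mul HasPartials.coord_z)
    (exp_pos Λ).le t
    (fun z => hz (exp Λ, z) (Or.inl (le_abs_self _)) _ _ _)
    (fun s => hz (s, exp Λ) (Or.inr (le_abs_self _)) _ _ _)
    (fun s => hz (s, -exp Λ) (Or.inr (by rw [abs_neg]; exact le_abs_self _)) _ _ _)
  simp only [mul_zero, intervalIntegral.integral_zero, neg_zero] at key
  rw [← key]
  refine setIntegral_congr_fun (measurableSet_box _) fun x _ => ?_
  have := (bracket_pos x).ne'
  have := (hr x).ne'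
  simp only [hardyDensity, zero_mul, add_zero]
  field_simp
  ring

theorem continuous_hardyDensity {δ Λ : ℝ} (hδ : 0 < δ) {f b c : ℝ × ℝ → ℝ} (hf : Continuous f)
    (hb : Continuous b) (hc : Continuous c) : Continuous (hardyDensity δ Λ f b c) := by
  have hr : ∀ x, 0 < √(1 + δ * bracket x) := fun x => sqrt_pos.2 (by
    have := bracket_pos x
    positivity)
  have cbr := continuous_bracket
  have cr : Continuous fun x => √(1 + δ * bracket x) := by fun_prop
  have cl := continuous_bracket.log fun x => (bracket_pos x).ne'
  have cθ := (continuous_cutoff Λ).comp cl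
  have cθ' := (continuous_cutoffDeriv Λ).comp cl
  have cri := cr.inv₀ fun x => (hr x).ne'
  have cr3 : Continuous fun x => δ * (x.1 ^ 2 + x.2 ^ 2) / √(1 + δ * bracket x) ^ 3 :=
    (by fun_prop : Continuous fun x : ℝ × ℝ => δ * (x.1 ^ 2 + x.2 ^ 2)).div (by fun_prop)
      fun x => pow_ne_zero 3 (hr x).ne'
  have cbi : Continuous fun x : ℝ × ℝ => 2 * (x.1 ^ 2 + x.2 ^ 2) / bracket x :=
    (by fun_prop : Continuous fun x : ℝ × ℝ => 2 * (x.1 ^ 2 + x.2 ^ 2)).div continuous_bracket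
      fun x => (bracket_pos x).ne'
  exact (((cri.mul cθ).mul (by fun_prop)).sub ((cr3.mul cθ).mul (by fun_prop))).add
    (((cri.mul cθ').mul cbi).mul (by fun_prop))

theorem hardyDensity_ge {p : ℝ} (hp1 : 1 < p) (hp5 : p < 5) {δ Λ : ℝ} (hδ : 0 < δ) (hΛ : 0 < Λ)
    (f b c : ℝ × ℝ → ℝ) (x : ℝ × ℝ) :
    (√(1 + δ * bracket x))⁻¹ * cutoff Λ (log (bracket x)) * f x ^ 2 / 2
      - 4 * (bracket x * ((b x ^ 2 + c x ^ 2) / 2 + pot p (f x)))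
      - 4 / Λ / √δ * ((p + 1) * (bracket x * ((b x ^ 2 + c x ^ 2) / 2 + pot p (f x)))
        + bracket x ^ (-(5 / 4) : ℝ)) ≤ hardyDensity δ Λ f b c x := by
  unfold hardyDensity
  have hr2 : √(1 + δ * bracket x) ^ 2 = 1 + δ * bracket x := sq_sqrt (by
    have := bracket_pos x
    positivity)
  have hr : 0 < √(1 + δ * bracket x) := sqrt_pos.2 (by
    have := bracket_pos x
    positivity)
  have hr1 : 1 ≤ √(1 + δ * bracket x) := by
    have := bracket_pos x
    exact one_le_sqrt.2 (by nlinarith)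
  have hθ0 : 0 ≤ cutoff Λ (log (bracket x)) := cutoff_nonneg _ _
  have hθ1 : cutoff Λ (log (bracket x)) ≤ 1 := cutoff_le_one hΛ (log_bracket_nonneg x)
  set r := √(1 + δ * bracket x) with hrdef
  set θ := cutoff Λ (log (bracket x)) with hθdef
  have hpot := pot_nonneg hp1 (f x)
  have hb := bracket_pos x
  have hb1 : bracket x = 1 + (x.1 ^ 2 + x.2 ^ 2) := by unfold bracket; ring
  have hρ : 0 ≤ x.1 ^ 2 + x.2 ^ 2 := by positivity
  have hy := sq_mul_rpow_le hp1 hp5 (abs_nonneg (f x)) (one_le_bracket x)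
  have hpow : |f x| ^ (p + 1) = (p + 1) * pot p (f x) := by
    have : p + 1 ≠ 0 := by linarith
    rw [pot, mul_div_cancel₀ _ this]
  rw [hpow, sq_abs] at hy
  have hri : (r)⁻¹ ≤ bracket x ^ (-(1 / 2) : ℝ) / √δ := by
    rw [rpow_neg hb.le, ← sqrt_eq_rpow, inv_eq_one_div, inv_eq_one_div, div_div, ← sqrt_mul hb.le]
    have : 0 < bracket x * δ := by positivity
    refine one_div_le_one_div_of_le (sqrt_pos.2 this) (sqrt_le_sqrt (by linarith))
  have hθ' := neg_le_cutoffDeriv hΛ (y := log (bracket x))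
    (log_bracket_nonneg x)
  have hA : (x.1 * b x + x.2 * c x) ^ 2
      ≤ bracket x * (b x ^ 2 + c x ^ 2) := by
    rw [hb1]
    nlinarith [sq_nonneg (x.1 * c x - x.2 * b x), sq_nonneg (b x), sq_nonneg (c x)]
  have hw0 : 0 ≤ (r)⁻¹ * θ := mul_nonneg (inv_pos.2 (hr)).le (hθ0)
  have hw1 : (r)⁻¹ * θ ≤ 1 := mul_le_one₀ (inv_le_one_of_one_le₀ (hr1)) (hθ0) (hθ1)
  have i1 : δ * (x.1 ^ 2 + x.2 ^ 2) / r ^ 3 * θ * f x ^ 2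
      ≤ (r)⁻¹ * θ * f x ^ 2 := by
    have : δ * (x.1 ^ 2 + x.2 ^ 2) / r ^ 3 ≤ (r)⁻¹ := by
      have := hr
      rw [div_le_iff₀ (by positivity), show (r)⁻¹ * r ^ 3 = r ^ 2 by field_simp, hr2, hb1]
      nlinarith
    have := hθ0
    gcongr
  have i2 : -(4 / Λ / √δ * ((p + 1) * (bracket x * pot p (f x)) + bracket x ^ (-(5 / 4) : ℝ)))
      ≤ (r)⁻¹ * cutoffDeriv Λ (log (bracket x)) * (2 * (x.1 ^ 2 + x.2 ^ 2) / bracket x)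
      * f x ^ 2 := by
    have j1 : 2 * (x.1 ^ 2 + x.2 ^ 2) / bracket x ≤ 2 := by
      rw [div_le_iff₀ hb]; linarith
    have j2 : (r)⁻¹ * (-cutoffDeriv Λ (log (bracket x)))
        * (2 * (x.1 ^ 2 + x.2 ^ 2) / bracket x) * f x ^ 2
        ≤ (bracket x ^ (-(1 / 2) : ℝ) / √δ) * (2 / Λ) * 2 * f x ^ 2 := by
      have j3 := cutoffDeriv_nonpos hΛ (log (bracket x))
      have j4 : -cutoffDeriv Λ (log (bracket x)) ≤ 2 / Λ := by linarith
      have j5 : 0 ≤ -cutoffDeriv Λ (log (bracket x)) := by linarith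
      have := hr
      gcongr
    have j6 : (bracket x ^ (-(1 / 2) : ℝ) / √δ) * (2 / Λ) * 2 * f x ^ 2
        = 4 / Λ / √δ * (f x ^ 2 * bracket x ^ (-(1 / 2) : ℝ)) := by ring
    have j7 : 4 / Λ / √δ * (f x ^ 2 * bracket x ^ (-(1 / 2) : ℝ)) ≤
      4 / Λ / √δ * (bracket x * ((p + 1) * pot p (f x)) + bracket x ^ (-(5 / 4) : ℝ)) := by
      gcongr
    linarith
  have i3 : 0 ≤ 4 / Λ / √δ * ((p + 1) * (bracket x * ((b x ^ 2 + c x ^ 2) / 2))) := by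
    have : 0 < p + 1 := by linarith
    positivity
  have i4 : 0 ≤ bracket x * pot p (f x) := by positivity
  have i5 : (r)⁻¹ * θ * (x.1 * b x + x.2 * c x) ^ 2
      ≤ bracket x * (b x ^ 2 + c x ^ 2) :=
    (mul_le_of_le_one_left (sq_nonneg _) hw1).trans hA
  have i6 : 0 ≤ (r)⁻¹ * θ * (f x + 2 * (x.1 * b x + x.2 * c x)) ^ 2 := by
    positivity
  linarith

/-- A Hardy inequality on the half-plane. -/
theorem setIntegral_sq_le {p : ℝ} (hp1 : 1 < p) (hp5 : p < 5) {f ft b c : ℝ × ℝ × ℝ → ℝ}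
    (hf : HasPartials f ft b c) {t K : ℝ}
    (hK : ∀ M, ∫ x in box M, bracket x * ((b (t, x) ^ 2 + c (t, x) ^ 2) / 2 + pot p (f (t, x))) ≤ K)
    {M : ℝ} (hM : 1 ≤ M) : ∫ x in box M, f (t, x) ^ 2 ≤ 16 * (4 * K + 1) := by
  obtain ⟨c₀, hc₀, hc₀'⟩ := exists_setIntegral_box_rpow_le
  have cf : Continuous fun x => f (t, x) := hf.cont.comp (by fun_prop)
  have cb : Continuous fun x => b (t, x) := hf.cont_s.comp (by fun_prop)
  have cc : Continuous fun x => c (t, x) := hf.cont_z.comp (by fun_prop)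
  have hX0 := fun δ Λ hδ hΛ => setIntegral_hardyDensity hf t (δ := δ) (Λ := Λ) hδ hΛ
  generalize hf' : (fun x => f (t, x)) = f' at *
  generalize hb' : (fun x => b (t, x)) = b' at *
  generalize hc' : (fun x => c (t, x)) = c' at *
  have hK' : ∀ M, ∫ x in box M, bracket x * ((b' x ^ 2 + c' x ^ 2) / 2 + pot p (f' x)) ≤ K := by
    subst hf' hb' hc'
    exact hK
  suffices ∫ x in box M, f' x ^ 2 ≤ 16 * (4 * K + 1) by
    subst hf'
    exact this
  clear hf' hb' hc' hf hK
  rename' f => f₀, b => b₀, c => c₀'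
  rename' f' => f, b' => b, c' => c
  have cpot := continuous_pot hp1
  have cbr : Continuous fun x : ℝ × ℝ => bracket x ^ (-(5 / 4) : ℝ) :=
    continuous_bracket.rpow_const fun x => Or.inl (bracket_pos x).ne'
  have hK0 : 0 ≤ K := le_trans (setIntegral_nonneg (measurableSet_box 0) fun x _ => by
    have h1 := bracket_pos x
    have h2 := pot_nonneg hp1 (f x)
    positivity) (hK' 0)
  set δ := 1 / (3 * M ^ 2) with hδdef
  have hδ : 0 < δ := by positivity
  set D := 4 * ((p + 1) * K + c₀) / √δ with hD
  have hD0 : 0 ≤ D := by positivity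
  set Λ := 2 * log (3 * M ^ 2) + D + 1 with hΛdef
  have hlog : 0 ≤ log (3 * M ^ 2) := log_nonneg (by nlinarith)
  have hΛ : 0 < Λ := by positivity
  have hMΛ : M ≤ exp Λ := by
    have h1 : log M ≤ log (3 * M ^ 2) := log_le_log (by linarith) (by nlinarith)
    rw [← exp_log (show 0 < M by linarith)]
    exact exp_le_exp.2 (by linarith)
  set r : ℝ × ℝ → ℝ := fun x => √(1 + δ * bracket x) with hrdef
  have hr2 : ∀ x, r x ^ 2 = 1 + δ * bracket x := fun x => sq_sqrt (by
    have := bracket_pos x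
    positivity)
  have hr : ∀ x, 0 < r x := fun x => sqrt_pos.2 (by
    have := bracket_pos x
    positivity)
  have hr1 : ∀ x, 1 ≤ r x := fun x => by
    have := bracket_pos x
    exact one_le_sqrt.2 (by nlinarith)
  have cr : Continuous r := by fun_prop
  set θ : ℝ × ℝ → ℝ := fun x => cutoff Λ (log (bracket x)) with hθdef
  have hθ0 : ∀ x, 0 ≤ θ x := fun x => cutoff_nonneg _ _
  have hθ1 : ∀ x, θ x ≤ 1 := fun x => cutoff_le_one hΛ (log_bracket_nonneg x)
  have cθ : Continuous θ := (continuous_cutoff Λ).comp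
    (continuous_bracket.log fun x => (bracket_pos x).ne')
  set e : ℝ × ℝ → ℝ := fun x => (b x ^ 2 + c x ^ 2) / 2 + pot p (f x) with hedef
  have ce : Continuous e := by fun_prop
  have cri := cr.inv₀ fun x => (hr x).ne'
  have c1 : Continuous fun x => (r x)⁻¹ * θ x * f x ^ 2 := (cri.mul cθ).mul (cf.pow 2)
  have cX := continuous_hardyDensity (Λ := Λ) hδ cf cb cc
  have cbk := continuous_bracket
  have hpt' : ∀ x ∈ box (exp Λ), (r x)⁻¹ * θ x * f x ^ 2 ≤ 2 * hardyDensity δ Λ f b c x + (8 * (bracket x * e x)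
      + 8 / Λ / √δ * ((p + 1) * (bracket x * e x) + bracket x ^ (-(5 / 4) : ℝ))) := fun x _ => by
    have : (r x)⁻¹ * θ x * f x ^ 2 / 2 - 4 * (bracket x * e x) - 4 / Λ / √δ * ((p + 1)
        * (bracket x * e x) + bracket x ^ (-(5 / 4) : ℝ)) ≤ hardyDensity δ Λ f b c x :=
      hardyDensity_ge hp1 hp5 hδ hΛ f b c x
    have e1 : 8 / Λ / √δ = 2 * (4 / Λ / √δ) := by ring
    rw [e1]
    linarith
  have hle := setIntegral_box_mono c1 (by fun_prop) hpt'
  rw [integral_add (Continuous.integrableOn_box (by fun_prop) _)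
      (Continuous.integrableOn_box (by fun_prop) _),
    integral_add (Continuous.integrableOn_box (by fun_prop) _)
      (Continuous.integrableOn_box (by fun_prop) _), integral_const_mul, integral_const_mul,
    integral_const_mul, integral_add (Continuous.integrableOn_box (by fun_prop) _)
      (Continuous.integrableOn_box cbr _), integral_const_mul, hX0 δ Λ hδ hΛ] at hle
  have hKΛ : (p + 1) * (∫ x in box (exp Λ), bracket x * e x)
      + ∫ x in box (exp Λ), bracket x ^ (-(5 / 4) : ℝ) ≤ (p + 1) * K + c₀ :=
    add_le_add (mul_le_mul_of_nonneg_left (hK' _) (by linarith)) (hc₀' _)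
  have hsm : 8 / Λ / √δ * ((p + 1) * K + c₀) ≤ 2 := by
    have h3 : 0 < √δ := sqrt_pos.2 hδ
    have h4 : 8 / Λ / √δ * ((p + 1) * K + c₀) = 2 * D / Λ := by
      rw [hD]
      field_simp
      ring
    rw [h4, div_le_iff₀ hΛ]
    linarith
  have hup : ∫ x in box (exp Λ), (r x)⁻¹ * θ x * f x ^ 2 ≤ 2 * (4 * K + 1) := by
    have h3 : 8 / Λ / √δ * ((p + 1) * (∫ x in box (exp Λ), bracket x * e x)
      + ∫ x in box (exp Λ), bracket x ^ (-(5 / 4) : ℝ)) ≤ 8 / Λ / √δ * ((p + 1) * K + c₀) :=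
      mul_le_mul_of_nonneg_left hKΛ (by positivity)
    have h4 := hK' (exp Λ)
    linarith
  have hlow : ∀ x ∈ box M, f x ^ 2 ≤ 8 * ((r x)⁻¹ * θ x * f x ^ 2) := fun x hx => by
    have h3 : 1 / 2 ≤ (r x)⁻¹ := by
      rw [one_div]
      refine inv_anti₀ (hr x) (sqrt_le_iff.2 ⟨by norm_num, ?_⟩)
      have h4 := bracket_le hM hx
      have h5 : δ * bracket x ≤ δ * (3 * M ^ 2) := by gcongr
      have h6 : δ * (3 * M ^ 2) = 1 := by
        rw [hδdef]
        field_simp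
      linarith
    have h4 : 1 / 4 ≤ θ x := by
      have h5 : log (bracket x) ≤ log (3 * M ^ 2) := log_le_log (bracket_pos x) (bracket_le hM hx)
      have := cutoff_ge_quarter hΛ (y := log (bracket x)) (by linarith)
      simp only [hθdef]
      linarith
    have h5 : 1 / 2 * (1 / 4) ≤ (r x)⁻¹ * θ x := by gcongr
    nlinarith [sq_nonneg (f x)]
  calc ∫ x in box M, f x ^ 2 ≤ ∫ x in box M, 8 * ((r x)⁻¹ * θ x * f x ^ 2) :=
        setIntegral_box_mono (by fun_prop) (c1.const_mul 8) hlow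
    _ = 8 * ∫ x in box M, (r x)⁻¹ * θ x * f x ^ 2 := integral_const_mul _ _
    _ ≤ 8 * ∫ x in box (exp Λ), (r x)⁻¹ * θ x * f x ^ 2 := by
        refine mul_le_mul_of_nonneg_left (setIntegral_box_le_of_subset c1 (fun x => ?_) hMΛ)
          (by norm_num)
        have := hr x
        have := hθ0 x
        positivity
    _ ≤ 16 * (4 * K + 1) := by linarith

theorem continuous_setIntegral_box {G : ℝ × ℝ × ℝ → ℝ} (hG : Continuous G) (M : ℝ) :
    Continuous fun t => ∫ x in box M, G (t, x) :=
  continuous_parametric_integral_of_continuous (f := fun t x => G (t, x))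
    (by simpa [Function.uncurry_def] using hG) (isCompact_box M)

/-- The energy component of the current of the vector field
`(1 + s² + z²) ∂ₜ + (z² - s²) ∂₁ - 2 s z ∂₂`. -/
def currentT (p : ℝ) (f a b c : ℝ × ℝ × ℝ → ℝ) (q : ℝ × ℝ × ℝ) : ℝ :=
  bracket q.2 * energy p f a b c q
    + a q * ((q.2.2 * q.2.2 - q.2.1 * q.2.1) * b q + -2 * (q.2.1 * q.2.2) * c q)
    - q.2.1 * f q * a q - 1 / 2 * (f q * f q)

/-- The flux of the current through the hypersurfaces `s = x₁ - t = const`. -/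
def currentS (p : ℝ) (f a b c : ℝ × ℝ × ℝ → ℝ) (q : ℝ × ℝ × ℝ) : ℝ :=
  currentT p f a b c q + (b q * (bracket q.2 * a q
      + ((q.2.2 * q.2.2 - q.2.1 * q.2.1) * b q + -2 * (q.2.1 * q.2.2) * c q))
    - (q.2.2 * q.2.2 - q.2.1 * q.2.1) * (energy p f a b c q - a q * a q)
    - q.2.1 * f q * b q + 1 / 2 * (f q * f q))

/-- The flux of the current in the direction `x₂`. -/
def currentZ (p : ℝ) (f a b c : ℝ × ℝ × ℝ → ℝ) (q : ℝ × ℝ × ℝ) : ℝ :=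
  c q * (bracket q.2 * a q
      + ((q.2.2 * q.2.2 - q.2.1 * q.2.1) * b q + -2 * (q.2.1 * q.2.2) * c q))
    - -2 * (q.2.1 * q.2.2) * (energy p f a b c q - a q * a q) - q.2.1 * f q * c q

theorem currentS_zero (p : ℝ) (f a b c : ℝ × ℝ × ℝ → ℝ) (t z : ℝ) :
    currentS p f a b c (t, 0, z) = (z ^ 2 + 1 / 2) * (a (t, 0, z) + b (t, 0, z)) ^ 2
      + 1 / 2 * c (t, 0, z) ^ 2 + pot p (f (t, 0, z)) := by
  unfold currentS currentT energy bracket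
  ring

theorem abs_mul_le_energy {p : ℝ} (hp : 1 < p) (f a b c : ℝ × ℝ × ℝ → ℝ) (q : ℝ × ℝ × ℝ) :
    (|a q * b q| ≤ energy p f a b c q ∧ |a q * c q| ≤ energy p f a b c q) ∧
      |b q * c q| ≤ energy p f a b c q := by
  have := pot_nonneg hp (f q)
  unfold energy
  simp only [abs_le]
  refine ⟨⟨⟨?_, ?_⟩, ?_, ?_⟩, ?_, ?_⟩ <;>
  nlinarith [sq_nonneg (a q + b q), sq_nonneg (a q - b q), sq_nonneg (c q), sq_nonneg (a q),
    sq_nonneg (a q + c q), sq_nonneg (a q - c q), sq_nonneg (b q), sq_nonneg (b q + c q),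
    sq_nonneg (b q - c q)]

theorem neg_le_currentT {p : ℝ} (hp : 1 < p) (f a b c : ℝ × ℝ × ℝ → ℝ) (q : ℝ × ℝ × ℝ) :
    -((q.2.1 * b q + q.2.2 * c q) * f q + f q ^ 2) ≤ currentT p f a b c q := by
  have h := pot_nonneg hp (f q)
  have h1 : 0 ≤ (q.2.1 ^ 2 + q.2.2 ^ 2) * pot p (f q) := by positivity
  unfold currentT energy bracket
  linarith [sq_nonneg (q.2.2 * a q + (q.2.2 * b q - q.2.1 * c q)),
    sq_nonneg (q.2.1 * a q - (q.2.1 * b q + q.2.2 * c q) - f q), sq_nonneg (a q), sq_nonneg (b q),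
    sq_nonneg (c q)]

theorem currentT_le {p : ℝ} (hp : 1 < p) (f a b c : ℝ × ℝ × ℝ → ℝ) (q : ℝ × ℝ × ℝ) :
    currentT p f a b c q
      ≤ 2 * (bracket q.2 * (a q ^ 2 + b q ^ 2 + c q ^ 2 + |f q| ^ (p + 1))) := by
  have h : pot p (f q) ≤ |f q| ^ (p + 1) := div_le_self (by positivity) (by linarith)
  have h0 := pot_nonneg hp (f q)
  have hb := bracket_pos q.2
  have h1 := mul_le_mul_of_nonneg_left h hb.le
  have h2 := mul_nonneg hb.le h0
  have h3 : 0 ≤ (q.2.1 * a q + f q) ^ 2 := sq_nonneg _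
  unfold currentT energy
  unfold bracket at *
  nlinarith [sq_nonneg (q.2.2 * a q - (q.2.2 * b q - q.2.1 * c q)),
    sq_nonneg (q.2.1 * a q + (q.2.1 * b q + q.2.2 * c q)), sq_nonneg (a q), sq_nonneg (b q),
    sq_nonneg (c q), sq_nonneg (q.2.1 * a q), sq_nonneg (q.2.2 * a q), sq_nonneg (q.2.1 * b q),
    sq_nonneg (q.2.2 * b q), sq_nonneg (q.2.1 * c q), sq_nonneg (q.2.2 * c q)]

namespace IsNullSol

variable {p : ℝ} {f a b c att atx aty bxx bxy cyy : ℝ × ℝ × ℝ → ℝ}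

theorem exists_hasPartials_current (h : IsNullSol p f a b c att atx aty bxx bxy cyy) (hp : 1 < p) :
    ∃ Pt Ps Pz Qt Qs Qz St Ss Sz, HasPartials (currentT p f a b c) Pt Ps Pz ∧
      HasPartials (currentS p f a b c) Qt Qs Qz ∧ HasPartials (currentZ p f a b c) St Ss Sz ∧
      ∀ q, Pt q - Qs q - Sz q = -((5 - p) * (q.2.1 * pot p (f q))) := by
  have hE := h.hasPartials_energy hp
  have hs := HasPartials.coord_s
  have hz := HasPartials.coord_z
  have hX := (hz.mul hz).sub (hs.mul hs)
  have hY := (HasPartials.const (-2)).mul (hs.mul hz)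
  have hZ := (hX.mul h.hb).add (hY.mul h.hc)
  have hW := (hasPartials_bracket.mul h.ha).add hZ
  have hf2 := (HasPartials.const (1 / 2)).mul (h.hf.mul h.hf)
  have hsf := hs.mul h.hf
  have hG := hE.sub (h.ha.mul h.ha)
  have hP := (((hasPartials_bracket.mul hE).add (h.ha.mul hZ)).sub (hsf.mul h.ha)).sub hf2
  have hQ := hP.add ((((h.hb.mul hW).sub (hX.mul hG)).sub (hsf.mul h.hb)).add hf2)
  have hS := ((h.hc.mul hW).sub (hY.mul hG)).sub (hsf.mul h.hc)
  refine ⟨_, _, _, _, _, _, _, _, _, hP, hQ, hS, fun q => ?_⟩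
  have hw := h.wave q
  have hV := abs_rpow_mul_sq hp (f q)
  have he : energy p f a b c q = (a q ^ 2 + b q ^ 2 + c q ^ 2) / 2 + pot p (f q) := rfl
  simp only [he, bracket]
  linear_combination ((1 + q.2.1 ^ 2 + q.2.2 ^ 2) * a q + (q.2.2 ^ 2 - q.2.1 ^ 2) * b q
    - 2 * q.2.1 * q.2.2 * c q - q.2.1 * f q) * hw + q.2.1 * hV

end IsNullSol

theorem abs_current_le {p : ℝ} (hp : 1 < p) (f a b c : ℝ × ℝ × ℝ → ℝ) (q : ℝ × ℝ × ℝ) :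
    |currentS p f a b c q| ≤ 10 * (bracket q.2 * energy p f a b c q + f q ^ 2) ∧
      |currentZ p f a b c q| ≤ 10 * (bracket q.2 * energy p f a b c q + f q ^ 2) := by
  have hV := pot_nonneg hp (f q)
  have he : energy p f a b c q = (a q ^ 2 + b q ^ 2 + c q ^ 2) / 2 + pot p (f q) := rfl
  have hn : bracket q.2 = 1 + q.2.1 ^ 2 + q.2.2 ^ 2 := rfl
  have hn0 := bracket_pos q.2
  have h0 := energy_nonneg hp f a b c q
  obtain ⟨⟨hab, hac⟩, hbc⟩ := abs_mul_le_energy hp f a b c q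
  have haa : |a q * a q| ≤ 2 * energy p f a b c q := by
    rw [abs_mul_self, he]; nlinarith [sq_nonneg (b q), sq_nonneg (c q)]
  have hbb : |b q * b q| ≤ 2 * energy p f a b c q := by
    rw [abs_mul_self, he]; nlinarith [sq_nonneg (a q), sq_nonneg (c q)]
  have hcc : |c q * c q| ≤ 2 * energy p f a b c q := by
    rw [abs_mul_self, he]; nlinarith [sq_nonneg (a q), sq_nonneg (b q)]
  have hG : |energy p f a b c q - a q * a q| ≤ energy p f a b c q := by
    rw [abs_le, he]
    constructor <;> nlinarith [sq_nonneg (a q), sq_nonneg (b q), sq_nonneg (c q)]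
  have hX : |q.2.2 * q.2.2 - q.2.1 * q.2.1| ≤ bracket q.2 := by
    rw [abs_le, hn]
    constructor <;> nlinarith [sq_nonneg q.2.1, sq_nonneg q.2.2]
  have hY : |-2 * (q.2.1 * q.2.2)| ≤ bracket q.2 := by
    rw [abs_le, hn]
    constructor <;> nlinarith [sq_nonneg (q.2.1 + q.2.2), sq_nonneg (q.2.1 - q.2.2)]
  have hs : q.2.1 ^ 2 ≤ bracket q.2 := by rw [hn]; nlinarith [sq_nonneg q.2.2]
  have key : ∀ {X Y k : ℝ}, |X| ≤ bracket q.2 → |Y| ≤ k * energy p f a b c q →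
      |X * Y| ≤ k * (bracket q.2 * energy p f a b c q) := fun {X Y k} h1 h2 => by
    rw [abs_mul]
    calc |X| * |Y| ≤ bracket q.2 * (k * energy p f a b c q) := by gcongr
      _ = _ := by ring
  have hsf : ∀ y, |y * y| ≤ 2 * energy p f a b c q →
      |q.2.1 * f q * y| ≤ bracket q.2 * energy p f a b c q + 1 / 2 * f q ^ 2 := fun y hy => by
    have h1 : q.2.1 ^ 2 * y ^ 2 ≤ bracket q.2 * (2 * energy p f a b c q) := by
      rw [abs_mul_self, ← sq] at hy
      gcongr
    rw [abs_le]
    constructor <;> nlinarith [sq_nonneg (q.2.1 * y + f q), sq_nonneg (q.2.1 * y - f q)]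
  have n1 : |bracket q.2| ≤ bracket q.2 := (abs_of_pos hn0).le
  have k1 := abs_le.1 (key hX (hab.trans (one_mul _).ge))
  have k2 := abs_le.1 (key hY (hac.trans (one_mul _).ge))
  have k3 := abs_le.1 (key n1 (hab.trans (one_mul _).ge))
  have k4 := abs_le.1 (key hX hbb)
  have k5 := abs_le.1 (key hY (hbc.trans (one_mul _).ge))
  have k6 := abs_le.1 (key hX (hG.trans (one_mul _).ge))
  have k7 := abs_le.1 (key n1 (hac.trans (one_mul _).ge))
  have k8 := abs_le.1 (key hX (hbc.trans (one_mul _).ge))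
  have k9 := abs_le.1 (key hY hcc)
  have k10 := abs_le.1 (key hY (hG.trans (one_mul _).ge))
  have k11 := abs_le.1 (hsf _ haa)
  have k12 := abs_le.1 (hsf _ hbb)
  have k13 := abs_le.1 (hsf _ hcc)
  have hne := mul_nonneg hn0.le h0
  have hff := sq_nonneg (f q)
  unfold currentS currentT currentZ
  simp only [abs_le]
  generalize bracket q.2 = n at *
  generalize energy p f a b c q = e at *
  refine ⟨⟨?_, ?_⟩, ?_, ?_⟩ <;> linarith

namespace IsNullSol

variable {p : ℝ} {f a b c att atx aty bxx bxy cyy : ℝ × ℝ × ℝ → ℝ}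

theorem setIntegral_energy_le (h : IsNullSol p f a b c att atx aty bxx bxy cyy) (hp : 1 < p)
    {T K : ℝ} (hT : 0 ≤ T) (hK : ∀ M, ∫ x in box M, bracket x * energy p f a b c (0, x) ≤ K) (M : ℝ) :
    ∫ x in box M, bracket x * energy p f a b c (T, x) ≤ 4 * (exp (3 * T) * K) := by
  have ce := h.continuous_energy hp
  have hc : ∀ t, Continuous fun x : ℝ × ℝ => bracket x * energy p f a b c (t, x) := fun t => by
    fun_prop
  have h0 : ∀ t x, 0 ≤ bracket x * energy p f a b c (t, x) := fun t x =>
    mul_nonneg (bracket_pos x).le (energy_nonneg hp f a b c (t, x))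
  set N := max M 1 with hN
  have hN1 : 1 ≤ N := le_max_right _ _
  refine (setIntegral_box_le_of_subset (hc T) (h0 T) (le_max_left M 1)).trans ?_
  set Λ := 2 * (log (3 * N ^ 2) + 3 * T + 1) with hΛdef
  have hlog : 0 ≤ log (3 * N ^ 2) := log_nonneg (by nlinarith)
  have hΛ : 0 < Λ := by positivity
  have hNΛ : N ≤ exp Λ := by
    have h1 : log N ≤ log (3 * N ^ 2) := log_le_log (by linarith) (by nlinarith)
    rw [← exp_log (show 0 < N by linarith)]
    exact exp_le_exp.2 (by linarith)
  have cc : Continuous fun x : ℝ × ℝ => cutoff Λ (log (bracket x) + 3 * T) :=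
    (continuous_cutoff Λ).comp
      ((continuous_bracket.log fun x => (bracket_pos x).ne').add continuous_const)
  have c1 : Continuous fun x : ℝ × ℝ => bracket x * energy p f a b c (T, x)
      * cutoff Λ (log (bracket x) + 3 * T) := (hc T).mul cc
  calc ∫ x in box N, bracket x * energy p f a b c (T, x)
      ≤ ∫ x in box N, 4 * (bracket x * energy p f a b c (T, x)
          * cutoff Λ (log (bracket x) + 3 * T)) :=
        setIntegral_box_mono (hc T) (c1.const_mul 4) fun x hx => by
          have h1 := log_bracket_le hN1 hx
          have h2 := cutoff_ge_quarter hΛ (y := log (bracket x) + 3 * T) (by linarith)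
          nlinarith [mul_le_mul_of_nonneg_left h2 (h0 T x)]
    _ = 4 * ∫ x in box N, bracket x * energy p f a b c (T, x)
          * cutoff Λ (log (bracket x) + 3 * T) := integral_const_mul _ _
    _ ≤ 4 * ∫ x in box (exp Λ), bracket x * energy p f a b c (T, x)
          * cutoff Λ (log (bracket x) + 3 * T) :=
        mul_le_mul_of_nonneg_left (setIntegral_box_le_of_subset c1
          (fun x => mul_nonneg (h0 T x) (cutoff_nonneg _ _)) hNΛ) (by norm_num)
    _ ≤ 4 * (exp (3 * T) * K) := by
        gcongr
        exact (h.setIntegral_cutoff_energy_le hp hΛ hT).trans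
          (mul_le_mul_of_nonneg_left (hK _) (exp_pos _).le)

theorem setIntegral_cutoff_currentT_ge (h : IsNullSol p f a b c att atx aty bxx bxy cyy)
    (hp : 1 < p) (hcT : Continuous (currentT p f a b c)) {Λ : ℝ} (hΛ : 0 < Λ) (t : ℝ) :
    -(2 / Λ * ∫ x in box (exp Λ), f (t, x) ^ 2)
      ≤ ∫ x in box (exp Λ), cutoff Λ (log (bracket x)) * currentT p f a b c (t, x) := by
  have cf := h.hf.cont
  have cb := h.hf.cont_s
  have cc := h.hf.cont_z
  have cl : Continuous fun x => log (bracket x) :=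
    continuous_bracket.log fun x => (bracket_pos x).ne'
  have cθ : Continuous fun x => cutoff Λ (log (bracket x)) := (continuous_cutoff Λ).comp cl
  have cθ' : Continuous fun x => cutoffDeriv Λ (log (bracket x)) := (continuous_cutoffDeriv Λ).comp cl
  have cbi : Continuous fun x : ℝ × ℝ => 2 * (x.1 ^ 2 + x.2 ^ 2) / bracket x :=
    (by fun_prop : Continuous fun x : ℝ × ℝ => 2 * (x.1 ^ 2 + x.2 ^ 2)).div continuous_bracket
      fun x => (bracket_pos x).ne'
  set X : ℝ × ℝ → ℝ := fun x => cutoff Λ (log (bracket x)) * (2 * f (t, x) ^ 2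
    + 2 * ((x.1 * b (t, x) + x.2 * c (t, x)) * f (t, x)))
    + cutoffDeriv Λ (log (bracket x)) * (2 * (x.1 ^ 2 + x.2 ^ 2) / bracket x) * f (t, x) ^ 2 with hX
  have cX : Continuous X := by fun_prop
  have hζ := (hasPartials_cutoff Λ 0).mul (h.hf.mul h.hf)
  have hz : ∀ x : ℝ × ℝ, (exp Λ ≤ |x.1| ∨ exp Λ ≤ |x.2|) → ∀ B C : ℝ,
      cutoff Λ (log (bracket x) + 0 * t) * B * C = 0 := fun x hx B C => by
    rw [cutoff_eq_zero hΛ (by linarith [le_log_bracket hΛ.le hx])]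
    ring
  have key := (hζ.mul HasPartials.coord_s).setIntegral_box_divergence (hζ.mul HasPartials.coord_z)
    (exp_pos Λ).le t
    (fun z => hz (exp Λ, z) (Or.inl (le_abs_self _)) _ _)
    (fun s => hz (s, exp Λ) (Or.inr (le_abs_self _)) _ _)
    (fun s => hz (s, -exp Λ) (Or.inr (by rw [abs_neg]; exact le_abs_self _)) _ _)
  simp only [mul_zero, intervalIntegral.integral_zero, neg_zero] at key
  have hX0 : ∫ x in box (exp Λ), X x = 0 := by
    rw [← key]
    refine setIntegral_congr_fun (measurableSet_box _) fun x _ => ?_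
    have := (bracket_pos x).ne'
    simp only [hX, zero_mul, add_zero]
    field_simp
    ring
  have hpt : ∀ x ∈ box (exp Λ), -(1 / 2) * X x + -(2 / Λ) * f (t, x) ^ 2
      ≤ cutoff Λ (log (bracket x)) * currentT p f a b c (t, x) := fun x _ => by
    have h1 := mul_le_mul_of_nonneg_left (neg_le_currentT hp f a b c (t, x))
      (cutoff_nonneg Λ (log (bracket x)))
    have h2 := neg_le_cutoffDeriv hΛ (log_bracket_nonneg x)
    have h3 := cutoffDeriv_nonpos hΛ (log (bracket x))
    have h4 : 2 * (x.1 ^ 2 + x.2 ^ 2) / bracket x ≤ 2 := by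
      rw [div_le_iff₀ (bracket_pos x)]
      unfold bracket
      linarith
    have h5 : 0 ≤ 2 * (x.1 ^ 2 + x.2 ^ 2) / bracket x := by
      have := bracket_pos x
      positivity
    have h6 : -cutoffDeriv Λ (log (bracket x)) * (2 * (x.1 ^ 2 + x.2 ^ 2) / bracket x) * f (t, x) ^ 2
        ≤ 2 / Λ * 2 * f (t, x) ^ 2 := by
      have : -cutoffDeriv Λ (log (bracket x)) ≤ 2 / Λ := by linarith
      gcongr
    simp only [hX]
    linarith
  have hle := setIntegral_box_mono (by fun_prop) (by fun_prop) hpt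
  rw [integral_add (Continuous.integrableOn_box (by fun_prop) _)
      (Continuous.integrableOn_box (by fun_prop) _), integral_const_mul, integral_const_mul, hX0] at hle
  linarith

theorem integral_cutoff_currentS_le (h : IsNullSol p f a b c att atx aty bxx bxy cyy)
    (hp1 : 1 < p) (hp5 : p < 5) {T K K₁ K₂ : ℝ} (hT : 0 ≤ T)
    (hK : ∀ M, ∫ x in box M, bracket x * (a (0, x) ^ 2 + b (0, x) ^ 2 + c (0, x) ^ 2
      + |f (0, x)| ^ (p + 1)) ≤ K)
    (hK₁ : ∀ t ∈ Icc 0 T, ∀ M, ∫ x in box M, bracket x * energy p f a b c (t, x) ≤ K₁)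
    (hK₂ : ∀ t ∈ Icc 0 T, ∀ M, 1 ≤ M → ∫ x in box M, f (t, x) ^ 2 ≤ K₂) {Λ : ℝ} (hΛ : 0 < Λ) :
    ∫ t in (0:ℝ)..T, ∫ z in (-exp Λ)..exp Λ,
        cutoff Λ (log (bracket (0, z))) * currentS p f a b c (t, 0, z)
      ≤ 2 * K + (2 * K₂ + T * (40 * (K₁ + K₂))) / Λ := by
  obtain ⟨Pt, Ps, Pz, Qt, Qs, Qz, St, Ss, Sz, hP, hQ, hS, hdiv⟩ := h.exists_hasPartials_current hp1
  have hs : ∀ x : ℝ × ℝ, (exp Λ ≤ |x.1| ∨ exp Λ ≤ |x.2|) → ∀ t,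
      cutoff Λ (log (bracket x) + 0 * t) = 0 := fun x hx t =>
    cutoff_eq_zero hΛ (by linarith [le_log_bracket hΛ.le hx])
  have hω := hasPartials_cutoff Λ 0
  have key := integral_weighted_divergence_slab hω hP hQ hS (exp_pos Λ).le hT
    (fun t _ z => hs (_, _) (Or.inl (le_abs_self _)) t)
    (fun t _ s => hs (_, _) (Or.inr (le_abs_self _)) t)
    (fun t _ s => hs (_, _) (Or.inr (by rw [abs_neg]; exact le_abs_self _)) t)
  have ce := h.continuous_energy hp1
  have cf := h.hf.cont
  have ca := h.ha.cont
  have cb := h.hb.cont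
  have cc := h.hc.cont
  have cpow : Continuous fun x : ℝ × ℝ => |f (0, x)| ^ (p + 1) :=
    (cf.comp (by fun_prop : Continuous fun x : ℝ × ℝ => ((0 : ℝ), x))).abs.rpow_const
      fun x => Or.inr (by linarith)
  have cθ : Continuous fun x => cutoff Λ (log (bracket x)) :=
    (continuous_cutoff Λ).comp (continuous_bracket.log fun x => (bracket_pos x).ne')
  have cP := hP.cont
  have hbulk : ∀ t ∈ Icc 0 T, ∫ x in box (exp Λ),
      (cutoffDeriv Λ (log (bracket x) + 0 * t) * 0 * currentT p f a b c (t, x)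
        - cutoffDeriv Λ (log (bracket x) + 0 * t) * (2 * x.1 / bracket x) * currentS p f a b c (t, x)
        - cutoffDeriv Λ (log (bracket x) + 0 * t) * (2 * x.2 / bracket x) * currentZ p f a b c (t, x)
        + cutoff Λ (log (bracket x) + 0 * t) * (Pt (t, x) - Qs (t, x) - Sz (t, x)))
      ≤ 40 / Λ * (K₁ + K₂) := fun t ht => by
    have hpt : ∀ x ∈ box (exp Λ),
        (cutoffDeriv Λ (log (bracket x) + 0 * t) * 0 * currentT p f a b c (t, x)
          - cutoffDeriv Λ (log (bracket x) + 0 * t) * (2 * x.1 / bracket x)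
            * currentS p f a b c (t, x)
          - cutoffDeriv Λ (log (bracket x) + 0 * t) * (2 * x.2 / bracket x)
            * currentZ p f a b c (t, x)
          + cutoff Λ (log (bracket x) + 0 * t) * (Pt (t, x) - Qs (t, x) - Sz (t, x)))
        ≤ 40 / Λ * (bracket x * energy p f a b c (t, x) + f (t, x) ^ 2) := fun x hx => by
      have h1 := cutoff_nonneg Λ (log (bracket x) + 0 * t)
      have h2 : 0 ≤ (5 - p) * (x.1 * pot p (f (t, x))) :=
        mul_nonneg (by linarith) (mul_nonneg hx.1.1 (pot_nonneg hp1 _))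
      have h3 := cutoffDeriv_nonpos hΛ (log (bracket x) + 0 * t)
      have h4 := neg_le_cutoffDeriv hΛ (y := log (bracket x) + 0 * t)
        (by simpa using log_bracket_nonneg x)
      obtain ⟨h5, h6⟩ := abs_current_le hp1 f a b c (t, x)
      have hd : |cutoffDeriv Λ (log (bracket x) + 0 * t)| ≤ 2 / Λ := by
        rw [abs_le]
        have : 0 < 2 / Λ := by positivity
        constructor <;> linarith
      have hy : ∀ y J : ℝ, |2 * y| ≤ bracket x →
          |J| ≤ 10 * (bracket x * energy p f a b c (t, x) + f (t, x) ^ 2) →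
          |cutoffDeriv Λ (log (bracket x) + 0 * t) * (2 * y / bracket x) * J|
            ≤ 20 / Λ * (bracket x * energy p f a b c (t, x) + f (t, x) ^ 2) := fun y J hy hJ => by
        have hn := bracket_pos x
        have h7 : |2 * y / bracket x| ≤ 1 := by
          rw [abs_div, abs_of_pos hn, div_le_one hn]
          exact hy
        rw [abs_mul, abs_mul]
        calc |cutoffDeriv Λ (log (bracket x) + 0 * t)| * |2 * y / bracket x| * |J|
            ≤ 2 / Λ * 1 * (10 * (bracket x * energy p f a b c (t, x) + f (t, x) ^ 2)) := by gcongr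
          _ = _ := by ring
      have y1 := (abs_le.1 (hy x.1 _ (by
        rw [abs_le]; unfold bracket
        constructor <;> nlinarith [sq_nonneg (x.1 + 1), sq_nonneg (x.1 - 1), sq_nonneg x.2]) h5)).1
      have y2 := (abs_le.1 (hy x.2 _ (by
        rw [abs_le]; unfold bracket
        constructor <;> nlinarith [sq_nonneg (x.2 + 1), sq_nonneg (x.2 - 1), sq_nonneg x.1]) h6)).1
      have y3 := mul_nonneg h1 h2
      have e1 : 40 / Λ = 20 / Λ + 20 / Λ := by ring
      rw [hdiv, e1]
      linarith
    have cω := hω.cont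
    have cωt := hω.cont_t
    have cωs := hω.cont_s
    have cωz := hω.cont_z
    have cPt := hP.cont_t
    have cQ := hQ.cont
    have cQs := hQ.cont_s
    have cS := hS.cont
    have cSz := hS.cont_z
    have ct : Continuous fun x : ℝ × ℝ => (t, x) := by fun_prop
    have c1 := (((cωt.mul cP).sub (cωs.mul cQ)).sub (cωz.mul cS)).add
      (cω.mul ((cPt.sub cQs).sub cSz))
    refine (setIntegral_box_mono (c1.comp ct) (by fun_prop) hpt).trans ?_
    rw [integral_const_mul, integral_add (Continuous.integrableOn_box (by fun_prop) _)
      (Continuous.integrableOn_box (by fun_prop) _)]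
    have := hK₁ t ht (exp Λ)
    have := hK₂ t ht (exp Λ) (one_le_exp hΛ.le)
    gcongr
  have hbulk' := intervalIntegral.integral_mono_on (μ := volume) hT
    (Continuous.intervalIntegrable (continuous_setIntegral_box ((((hω.cont_t.mul cP).sub
      (hω.cont_s.mul hQ.cont)).sub (hω.cont_z.mul hS.cont)).add
      (hω.cont.mul ((hP.cont_t.sub hQ.cont_s).sub hS.cont_z))) (exp Λ)) 0 T)
    (intervalIntegrable_const (c := 40 / Λ * (K₁ + K₂))) hbulk
  rw [intervalIntegral.integral_const, smul_eq_mul, sub_zero] at hbulk'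
  have hend := h.setIntegral_cutoff_currentT_ge hp1 cP hΛ T
  have hend' : 2 / Λ * ∫ x in box (exp Λ), f (T, x) ^ 2 ≤ 2 / Λ * K₂ := by
    have := hK₂ T ⟨hT, le_rfl⟩ (exp Λ) (one_le_exp hΛ.le)
    gcongr
  have hstart : ∫ x in box (exp Λ), cutoff Λ (log (bracket x)) * currentT p f a b c (0, x)
      ≤ 2 * K := by
    refine (setIntegral_box_mono (by fun_prop) (by fun_prop) (g := fun x => 2 * (bracket x
      * (a (0, x) ^ 2 + b (0, x) ^ 2 + c (0, x) ^ 2 + |f (0, x)| ^ (p + 1)))) fun x _ => ?_).trans ?_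
    · have h1 := cutoff_nonneg Λ (log (bracket x))
      have h2 := cutoff_le_one hΛ (log_bracket_nonneg x)
      have h3 : 0 ≤ 2 * (bracket x
          * (a (0, x) ^ 2 + b (0, x) ^ 2 + c (0, x) ^ 2 + |f (0, x)| ^ (p + 1))) := by
        have := bracket_pos x
        positivity
      exact (mul_le_mul_of_nonneg_left (currentT_le hp1 f a b c (0, x)) h1).trans
        (mul_le_of_le_one_left h3 h2)
    · rw [integral_const_mul]
      linarith [hK (exp Λ)]
  simp only [zero_mul, add_zero, Pi.add_apply, Pi.sub_apply, Pi.mul_apply] at key hbulk'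
  have e2 : (2 * K₂ + T * (40 * (K₁ + K₂))) / Λ = 2 / Λ * K₂ + T * (40 / Λ * (K₁ + K₂)) := by ring
  rw [e2]
  linarith

theorem currentS_zero_nonneg (hp : 1 < p) (f a b c : ℝ × ℝ × ℝ → ℝ) (t z : ℝ) :
    0 ≤ currentS p f a b c (t, 0, z) := by
  have := pot_nonneg hp (f (t, 0, z))
  rw [currentS_zero]
  positivity

/-- The flux through the hypersurface `s = 0` is bounded by the weighted energy of the data. -/
theorem integral_currentS_le (h : IsNullSol p f a b c att atx aty bxx bxy cyy)
    (hp1 : 1 < p) (hp5 : p < 5) {T K : ℝ} (hT : 0 ≤ T)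
    (hK : ∀ M, ∫ x in box M, bracket x * (a (0, x) ^ 2 + b (0, x) ^ 2 + c (0, x) ^ 2
      + |f (0, x)| ^ (p + 1)) ≤ K) {M : ℝ} (hM : 1 ≤ M) :
    ∫ t in (0:ℝ)..T, ∫ z in (-M)..M, currentS p f a b c (t, 0, z) ≤ 2 * K := by
  have cf := h.hf.cont
  have ca := h.ha.cont
  have cb := h.hb.cont
  have cc := h.hc.cont
  have ce := h.continuous_energy hp1
  have cpot := continuous_pot hp1
  have cpow : Continuous fun x : ℝ × ℝ => |f (0, x)| ^ (p + 1) :=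
    (cf.comp (by fun_prop : Continuous fun x : ℝ × ℝ => ((0 : ℝ), x))).abs.rpow_const
      fun x => Or.inr (by linarith)
  have hE : ∀ M, ∫ x in box M, bracket x * energy p f a b c (0, x) ≤ K := fun M => by
    refine (setIntegral_box_mono (by fun_prop) (by fun_prop) fun x _ => ?_).trans (hK M)
    have h1 : pot p (f (0, x)) ≤ |f (0, x)| ^ (p + 1) :=
      div_le_self (by positivity) (by linarith)
    have := (bracket_pos x).le
    unfold energy
    gcongr
    linarith [sq_nonneg (a (0, x)), sq_nonneg (b (0, x)), sq_nonneg (c (0, x))]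
  have hK0 : 0 ≤ K := (setIntegral_nonneg (measurableSet_box 0) fun x _ =>
    mul_nonneg (bracket_pos x).le (energy_nonneg hp1 f a b c (0, x))).trans (hE 0)
  set K₁ := 4 * (exp (3 * T) * K)
  set K₂ := 16 * (4 * K₁ + 1)
  have hK₁ : ∀ t ∈ Icc 0 T, ∀ M, ∫ x in box M, bracket x * energy p f a b c (t, x) ≤ K₁ :=
    fun t ht M => (h.setIntegral_energy_le hp1 ht.1 hE M).trans (by
      have := ht.2
      show 4 * (exp (3 * t) * K) ≤ 4 * (exp (3 * T) * K)
      gcongr)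
  have hK₂ : ∀ t ∈ Icc 0 T, ∀ M, 1 ≤ M → ∫ x in box M, f (t, x) ^ 2 ≤ K₂ := fun t ht M hM => by
    refine setIntegral_sq_le hp1 hp5 h.hf (fun M => ?_) hM
    refine (setIntegral_box_mono (by fun_prop) (by fun_prop) fun x _ => ?_).trans (hK₁ t ht M)
    have := (bracket_pos x).le
    unfold energy
    gcongr
    linarith [sq_nonneg (a (t, x))]
  obtain ⟨Pt, Ps, Pz, Qt, Qs, Qz, St, Ss, Sz, -, hQ, -⟩ := h.exists_hasPartials_current hp1
  have cQ := hQ.cont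
  have cl : Continuous fun z : ℝ => log (bracket (0, z)) :=
    (continuous_bracket.comp (by fun_prop : Continuous fun z : ℝ => ((0 : ℝ), z))).log
      fun z => (bracket_pos _).ne'
  set I := ∫ t in (0:ℝ)..T, ∫ z in (-M)..M, currentS p f a b c (t, 0, z)
  set D := 2 * K₂ + T * (40 * (K₁ + K₂))
  set L := log (3 * M ^ 2)
  have hL : 0 ≤ L := log_nonneg (by nlinarith)
  have hmain : ∀ᶠ Λ in atTop, (1 - L / Λ) ^ 2 * I ≤ 2 * K + D / Λ := by
    filter_upwards [eventually_ge_atTop L, eventually_gt_atTop 0] with Λ h1 hΛ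
    have cθ : Continuous fun z : ℝ => cutoff Λ (log (bracket (0, z))) := (continuous_cutoff Λ).comp cl
    have hMΛ : M ≤ exp Λ := by
      have h2 : log M ≤ L := log_le_log (by linarith) (by nlinarith)
      rw [← exp_log (show 0 < M by linarith)]
      exact exp_le_exp.2 (by linarith)
    refine le_trans ?_ (h.integral_cutoff_currentS_le hp1 hp5 hT hK hK₁ hK₂ hΛ)
    rw [← intervalIntegral.integral_const_mul]
    have c1 := intervalIntegral.continuous_parametric_intervalIntegral_of_continuous' (μ := volume)
      (f := fun t z => currentS p f a b c (t, 0, z)) (by fun_prop) (-M) M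
    have c2 := intervalIntegral.continuous_parametric_intervalIntegral_of_continuous' (μ := volume)
      (f := fun t z => cutoff Λ (log (bracket (0, z))) * currentS p f a b c (t, 0, z))
      ((cθ.comp continuous_snd).mul (cQ.comp
        (by fun_prop : Continuous fun x : ℝ × ℝ => (x.1, (0 : ℝ), x.2)))) (-exp Λ) (exp Λ)
    refine intervalIntegral.integral_mono_on hT (Continuous.intervalIntegrable (c1.const_mul _) _ _)
      (c2.intervalIntegrable _ _) fun t _ => ?_
    have hnn : ∀ z, 0 ≤ cutoff Λ (log (bracket (0, z))) * currentS p f a b c (t, 0, z) := fun z =>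
      mul_nonneg (cutoff_nonneg _ _) (currentS_zero_nonneg hp1 f a b c t z)
    rw [← intervalIntegral.integral_const_mul]
    refine (intervalIntegral.integral_mono_on (by linarith)
      (Continuous.intervalIntegrable (by fun_prop) _ _)
      (Continuous.intervalIntegrable (by fun_prop) _ _) fun z hz => ?_).trans
      (intervalIntegral.integral_mono_interval (neg_le_neg hMΛ) (by linarith) hMΛ
        (ae_of_all _ hnn) (Continuous.intervalIntegrable (by fun_prop) _ _))
    refine mul_le_mul_of_nonneg_right (cutoff_ge hΛ (log_bracket_le hM ⟨⟨le_rfl, ?_⟩, hz⟩) h1)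
      (currentS_zero_nonneg hp1 f a b c t z)
    simp only
    linarith
  have l1 : Tendsto (fun Λ : ℝ => (1 - L / Λ) ^ 2 * I) atTop (nhds ((1 - 0) ^ 2 * I)) :=
    ((tendsto_const_nhds.sub (tendsto_const_nhds.div_atTop tendsto_id)).pow 2).mul_const I
  have l2 : Tendsto (fun Λ : ℝ => 2 * K + D / Λ) atTop (nhds (2 * K + 0)) :=
    tendsto_const_nhds.add (tendsto_const_nhds.div_atTop tendsto_id)
  have := le_of_tendsto_of_tendsto l1 l2 hmain
  simpa using this

end IsNullSol

/-- The derivative of `H` in the direction `v`. -/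
def dirDeriv {V : Type*} [NormedAddCommGroup V] [NormedSpace ℝ V] (v : V) (H : V → ℝ) (q : V) : ℝ :=
  fderiv ℝ H q v

theorem contDiff_dirDeriv {V : Type*} [NormedAddCommGroup V] [NormedSpace ℝ V] {H : V → ℝ}
    (hH : ContDiff ℝ (⊤ : ℕ∞) H) (v : V) : ContDiff ℝ (⊤ : ℕ∞) (dirDeriv v H) :=
  (hH.fderiv_right (m := (⊤ : ℕ∞)) (by simp)).clm_apply contDiff_const

theorem dirDeriv_comm {V : Type*} [NormedAddCommGroup V] [NormedSpace ℝ V] {H : V → ℝ}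
    (hH : ContDiff ℝ (⊤ : ℕ∞) H) (v w q : V) :
    dirDeriv v (dirDeriv w H) q = dirDeriv w (dirDeriv v H) q := by
  have hd : DifferentiableAt ℝ (fderiv ℝ H) q :=
    ((hH.fderiv_right (m := (⊤ : ℕ∞)) (by simp)).differentiable (by simp)) q
  have hsymm : IsSymmSndFDerivAt ℝ H q := hH.contDiffAt.isSymmSndFDerivAt
    (by simp only [minSmoothness_of_isRCLikeNormedField]; exact WithTop.coe_le_coe.2 (le_top : (2 : ℕ∞) ≤ ⊤))
  have key : ∀ v w : V, dirDeriv v (dirDeriv w H) q = fderiv ℝ (fderiv ℝ H) q v w := fun v w => by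
    have := (hd.hasFDerivAt.clm_apply (hasFDerivAt_const w q)).fderiv
    unfold dirDeriv
    rw [this]
    simp
  rw [key, key]
  exact hsymm v w

/-- The time direction in spacetime. -/
def dirT : ℝ × E2 := (1, 0)

/-- The `i`-th coordinate direction in spacetime. -/
def dirX (i : Fin 2) : ℝ × E2 := (0, EuclideanSpace.single i 1)

theorem hasDerivAt_time {H : ℝ × E2 → ℝ} (hH : ContDiff ℝ (⊤ : ℕ∞) H) (t : ℝ) (x : E2) :
    HasDerivAt (fun r => H (r, x)) (dirDeriv dirT H (t, x)) t :=
  ((hH.differentiable (by simp)) (t, x)).hasFDerivAt.comp_hasDerivAt t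
    ((hasDerivAt_id t).prodMk (hasDerivAt_const t x))

theorem pdx_slice {H : ℝ × E2 → ℝ} (hH : ContDiff ℝ (⊤ : ℕ∞) H) (i : Fin 2) (t : ℝ) (x : E2) :
    pdx i (fun y => H (t, y)) x = dirDeriv (dirX i) H (t, x) := by
  have := (((hH.differentiable (by simp)) (t, x)).hasFDerivAt.comp x
    ((hasFDerivAt_const t x).prodMk (hasFDerivAt_id x))).fderiv
  unfold pdx
  rw [show (fun y => H (t, y)) = H ∘ Prod.mk t from rfl, this]
  simp [dirDeriv, dirX]

/-- The spacetime point with null coordinates `(t, s, z)`, where `s = x₁ - t`. -/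
def nullPoint (q : ℝ × ℝ × ℝ) : ℝ × E2 := (q.1, mkE (q.2.1 + q.1) q.2.2)

theorem mkE_eq (a b : ℝ) :
    mkE a b = a • EuclideanSpace.single 0 (1 : ℝ) + b • EuclideanSpace.single 1 (1 : ℝ) := by
  ext i
  fin_cases i <;> simp [mkE]

theorem continuous_nullPoint : Continuous nullPoint := by
  unfold nullPoint
  simp only [mkE_eq]
  fun_prop

theorem hasPartials_comp_nullPoint {H : ℝ × E2 → ℝ} (hH : ContDiff ℝ (⊤ : ℕ∞) H) :
    HasPartials (fun q => H (nullPoint q))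
      (fun q => dirDeriv dirT H (nullPoint q) + dirDeriv (dirX 0) H (nullPoint q))
      (fun q => dirDeriv (dirX 0) H (nullPoint q))
      (fun q => dirDeriv (dirX 1) H (nullPoint q)) := by
  have hc : ∀ v, Continuous fun q => dirDeriv v H (nullPoint q) := fun v =>
    (contDiff_dirDeriv hH v).continuous.comp continuous_nullPoint
  have hd : ∀ q, HasFDerivAt H (fderiv ℝ H q) q := fun q =>
    ((hH.differentiable (by simp)) q).hasFDerivAt
  refine ⟨hH.continuous.comp continuous_nullPoint, (hc _).add (hc _), hc _, hc _, ?_, ?_, ?_⟩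
  · intro t s z
    have h1 : HasDerivAt (fun r => nullPoint (r, s, z)) (dirT + dirX 0) t := by
      simp only [nullPoint, mkE_eq]
      have := (hasDerivAt_id t).prodMk ((((hasDerivAt_id t).const_add s).smul_const
        (EuclideanSpace.single 0 (1 : ℝ) : E2)).add_const (z • EuclideanSpace.single 1 (1 : ℝ)))
      simpa [dirT, dirX] using this
    have := (hd (nullPoint (t, s, z))).comp_hasDerivAt t h1
    rw [map_add] at this
    exact this
  · intro t s z
    have h1 : HasDerivAt (fun r => nullPoint (t, r, z)) (dirX 0) s := by
      simp only [nullPoint, mkE_eq]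
      have := (hasDerivAt_const s t).prodMk ((((hasDerivAt_id s).add_const t).smul_const
        (EuclideanSpace.single 0 (1 : ℝ) : E2)).add_const (z • EuclideanSpace.single 1 (1 : ℝ)))
      simpa [dirX] using this
    exact (hd (nullPoint (t, s, z))).comp_hasDerivAt s h1
  · intro t s z
    have h1 : HasDerivAt (fun r => nullPoint (t, s, r)) (dirX 1) z := by
      simp only [nullPoint, mkE_eq]
      have := (hasDerivAt_const z t).prodMk (((hasDerivAt_id z).smul_const
        (EuclideanSpace.single 1 (1 : ℝ) : E2)).const_add
          ((s + t) • EuclideanSpace.single 0 (1 : ℝ)))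
      simpa [dirX] using this
    exact (hd (nullPoint (t, s, z))).comp_hasDerivAt z h1

theorem IsWaveSolR2.isNullSol {p : ℝ} {φ : ℝ → E2 → ℝ} (hφ : IsWaveSolR2 p φ)
    (hs : ContDiff ℝ (⊤ : ℕ∞) fun q : ℝ × E2 => φ q.1 q.2) :
    ∃ att atx aty bxx bxy cyy : ℝ × ℝ × ℝ → ℝ,
      IsNullSol p (fun q => φ q.1 (mkE (q.2.1 + q.1) q.2.2))
        (fun q => pt φ q.1 (mkE (q.2.1 + q.1) q.2.2))
        (fun q => pdx 0 (φ q.1) (mkE (q.2.1 + q.1) q.2.2))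
        (fun q => pdx 1 (φ q.1) (mkE (q.2.1 + q.1) q.2.2)) att atx aty bxx bxy cyy := by
  set F : ℝ × E2 → ℝ := fun q => φ q.1 q.2 with hF
  have ht : ∀ t x, pt φ t x = dirDeriv dirT F (t, x) := fun t x => (hasDerivAt_time hs t x).deriv
  have hx : ∀ i t x, pdx i (φ t) x = dirDeriv (dirX i) F (t, x) := fun i t x => pdx_slice hs i t x
  have htt : ∀ t x, ptt φ t x = dirDeriv dirT (dirDeriv dirT F) (t, x) := fun t x => by
    unfold ptt
    simp only [ht]
    exact (hasDerivAt_time (contDiff_dirDeriv hs dirT) t x).deriv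
  have hxx : ∀ i t x, pdx i (pdx i (φ t)) x = dirDeriv (dirX i) (dirDeriv (dirX i) F) (t, x) :=
    fun i t x => by
      rw [← pdx_slice (contDiff_dirDeriv hs _)]
      congr 1
      exact funext fun y => hx i t y
  have hT := hasPartials_comp_nullPoint (contDiff_dirDeriv hs dirT)
  have h0 := hasPartials_comp_nullPoint (contDiff_dirDeriv hs (dirX 0))
  have h1 := hasPartials_comp_nullPoint (contDiff_dirDeriv hs (dirX 1))
  simp only [ht, hx]
  refine ⟨fun q => dirDeriv dirT (dirDeriv dirT F) (nullPoint q),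
    fun q => dirDeriv (dirX 0) (dirDeriv dirT F) (nullPoint q),
    fun q => dirDeriv (dirX 1) (dirDeriv dirT F) (nullPoint q),
    fun q => dirDeriv (dirX 0) (dirDeriv (dirX 0) F) (nullPoint q),
    fun q => dirDeriv (dirX 1) (dirDeriv (dirX 0) F) (nullPoint q),
    fun q => dirDeriv (dirX 1) (dirDeriv (dirX 1) F) (nullPoint q),
    hasPartials_comp_nullPoint hs, hT, ?_, ?_, fun q => ?_⟩
  · simp only [dirDeriv_comm hs dirT] at h0
    exact h0
  · simp only [dirDeriv_comm hs dirT (dirX 1), dirDeriv_comm hs (dirX 0) (dirX 1)] at h1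
    exact h1
  · have := hφ q.1 (mkE (q.2.1 + q.1) q.2.2)
    rw [htt, lap, Fin.sum_univ_two, hxx, hxx] at this
    rw [← this]
    simp only [nullPoint]
    ring

theorem mkE_eq_toLp : (fun x : ℝ × ℝ => mkE x.1 x.2) =
    MeasurableEquiv.finTwoArrow.symm.trans (MeasurableEquiv.toLp 2 (Fin 2 → ℝ)) := by
  funext x
  ext i
  fin_cases i <;> simp [mkE]

theorem measurePreserving_mkE : MeasurePreserving fun x : ℝ × ℝ => mkE x.1 x.2 := by
  rw [mkE_eq_toLp]
  exact (EuclideanSpace.volume_preserving_symm_measurableEquiv_toLp (Fin 2)).symm.comp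
    (volume_preserving_finTwoArrow ℝ).symm

theorem norm_mkE_sq (a b : ℝ) : ‖mkE a b‖ ^ 2 = a ^ 2 + b ^ 2 := by
  rw [EuclideanSpace.norm_sq_eq]
  simp [mkE]

theorem e02Integrand_nonneg (p : ℝ) (φ₀ φ₁ : E2 → ℝ) (x : E2) : 0 ≤ e02Integrand p φ₀ φ₁ x := by
  unfold e02Integrand gradSq
  positivity

theorem measurableEmbedding_mkE : MeasurableEmbedding fun x : ℝ × ℝ => mkE x.1 x.2 := by
  rw [mkE_eq_toLp]
  exact MeasurableEquiv.measurableEmbedding _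

theorem integrable_comp_mkE {g : E2 → ℝ} (h : Integrable g) :
    Integrable fun x : ℝ × ℝ => g (mkE x.1 x.2) :=
  (measurePreserving_mkE.integrable_comp_emb measurableEmbedding_mkE).2 h

theorem setIntegral_box_le_E02R {p : ℝ} {φ₀ φ₁ : E2 → ℝ} (h : Integrable (e02Integrand p φ₀ φ₁))
    (M : ℝ) : ∫ x in box M, e02Integrand p φ₀ φ₁ (mkE x.1 x.2) ≤ E02R p φ₀ φ₁ := by
  unfold E02R
  rw [← measurePreserving_mkE.integral_comp measurableEmbedding_mkE]
  exact setIntegral_le_integral (integrable_comp_mkE h) (ae_of_all _ fun x => e02Integrand_nonneg ..)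

theorem integral_integral_le_of_forall_bounded {G : ℝ × ℝ → ℝ} (hG : Continuous G)
    (hnn : ∀ x, 0 ≤ G x) {T K : ℝ} (hT : 0 ≤ T)
    (hK : ∀ M, 1 ≤ M → ∫ t in (0:ℝ)..T, ∫ z in (-M)..M, G (t, z) ≤ K) :
    ∫ t in (0:ℝ)..T, ∫ z, G (t, z) ≤ K := by
  set μ : Measure (ℝ × ℝ) := (volume.restrict (Ioc 0 T)).prod volume with hμ
  have hr : ∀ M, μ.restrict (univ ×ˢ Ioc (-M) M)
      = (volume.restrict (Ioc 0 T)).prod (volume.restrict (Ioc (-M) M)) := fun M => by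
    rw [hμ, ← Measure.prod_restrict, Measure.restrict_univ]
  have hcover : AECover μ atTop fun M : ℝ => (univ : Set ℝ) ×ˢ Ioc (-M) M := by
    refine ⟨ae_of_all _ fun x => ?_, fun M => MeasurableSet.univ.prod measurableSet_Ioc⟩
    filter_upwards [eventually_gt_atTop |x.2|] with M hM
    have := abs_lt.1 hM
    exact ⟨mem_univ _, this.1, this.2.le⟩
  have hint : ∀ M, IntegrableOn G ((univ : Set ℝ) ×ˢ Ioc (-M) M) μ := fun M => by
    rw [IntegrableOn, hr, Measure.prod_restrict]
    exact (hG.continuousOn.integrableOn_compact (isCompact_Icc.prod isCompact_Icc)).mono_set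
      (prod_mono Ioc_subset_Icc_self Ioc_subset_Icc_self)
  have hb : ∀ᶠ M in atTop, ∫ x in (univ : Set ℝ) ×ˢ Ioc (-M) M, G x ∂μ ≤ K := by
    filter_upwards [eventually_ge_atTop 1] with M hM
    have h1 := hint M
    rw [IntegrableOn, hr] at h1
    rw [hr, integral_prod _ h1, ← intervalIntegral.integral_of_le hT]
    simp only [← intervalIntegral.integral_of_le (show -M ≤ M by linarith)]
    exact hK M hM
  have hGi := hcover.integrable_of_integral_bounded_of_nonneg_ae K hint (ae_of_all _ hnn) hb
  rw [intervalIntegral.integral_of_le hT, ← integral_prod _ hGi]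
  exact le_of_tendsto (hcover.integral_tendsto_of_countably_generated hGi) hb

theorem bracket_mul_le_e02Integrand {p : ℝ} (φ₀ φ₁ : E2 → ℝ) (x : ℝ × ℝ) :
    bracket x * (φ₁ (mkE x.1 x.2) ^ 2 + pdx 0 φ₀ (mkE x.1 x.2) ^ 2 + pdx 1 φ₀ (mkE x.1 x.2) ^ 2
      + |φ₀ (mkE x.1 x.2)| ^ (p + 1)) ≤ e02Integrand p φ₀ φ₁ (mkE x.1 x.2) := by
  have h1 : bracket x ≤ (1 + ‖mkE x.1 x.2‖) ^ 2 := by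
    have := norm_mkE_sq x.1 x.2
    unfold bracket
    nlinarith [norm_nonneg (mkE x.1 x.2)]
  unfold e02Integrand gradSq
  rw [Fin.sum_univ_two, ← mul_add]
  refine (mul_le_mul_of_nonneg_right h1 (by positivity)).trans (le_of_eq ?_)
  ring

/-- bound for the characteristic flux along the null hypersurface `{t = x₁}`. -/
theorem characteristic_flux_bound
    (p : ℝ) (hp1 : 1 < p) (hp5 : p < 5) :
    ∃ C > 0, ∀ φ : ℝ → E2 → ℝ,
      ContDiff ℝ (⊤ : ℕ∞) (fun q : ℝ × E2 => φ q.1 q.2) →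
      IsWaveSolR2 p φ →
      Integrable (e02Integrand p (φ 0) (pt φ 0)) →
      ∀ T : ℝ, 0 < T →
        (∫ t in (0:ℝ)..T, ∫ x₂ : ℝ,
            ((x₂^2 + 1/2) * (pt φ t (mkE t x₂) + pdx 0 (φ t) (mkE t x₂))^2
              + (1/2) * (pdx 1 (φ t) (mkE t x₂))^2
              + (1/(p+1)) * |φ t (mkE t x₂)| ^ (p+1)))
          ≤ C * E02R p (φ 0) (pt φ 0) := by
  refine ⟨2, two_pos, fun φ hs hφ hint T hT => ?_⟩
  obtain ⟨att, atx, aty, bxx, bxy, cyy, h⟩ := hφ.isNullSol hs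
  have cf := h.hf.cont
  have ca := h.ha.cont
  have cb := h.hb.cont
  have cc := h.hc.cont
  have cι : Continuous fun x : ℝ × ℝ => ((0 : ℝ), x) := by fun_prop
  have hK : ∀ M, ∫ x in box M, bracket x * (pt φ 0 (mkE (x.1 + 0) x.2) ^ 2
      + pdx 0 (φ 0) (mkE (x.1 + 0) x.2) ^ 2 + pdx 1 (φ 0) (mkE (x.1 + 0) x.2) ^ 2
      + |φ 0 (mkE (x.1 + 0) x.2)| ^ (p + 1)) ≤ E02R p (φ 0) (pt φ 0) := fun M => by
    refine le_trans ?_ (setIntegral_box_le_E02R hint M)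
    refine setIntegral_mono_on ?_ ?_ (measurableSet_box M) fun x _ => ?_
    · refine Continuous.integrableOn_box (continuous_bracket.mul ((((ca.comp cι).pow 2).add
        ((cb.comp cι).pow 2)).add ((cc.comp cι).pow 2) |>.add ((cf.comp cι).abs.rpow_const
        fun x => Or.inr (by linarith)))) M
    · exact (integrable_comp_mkE hint).integrableOn
    · simpa only [add_zero] using bracket_mul_le_e02Integrand (φ 0) (pt φ 0) x
  obtain ⟨Pt, Ps, Pz, Qt, Qs, Qz, St, Ss, Sz, -, hQ, -⟩ := h.exists_hasPartials_current hp1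
  have key := integral_integral_le_of_forall_bounded
    (hQ.cont.comp (by fun_prop : Continuous fun x : ℝ × ℝ => (x.1, (0 : ℝ), x.2)))
    (fun x => IsNullSol.currentS_zero_nonneg hp1 _ _ _ _ x.1 x.2) hT.le
    fun M hM => h.integral_currentS_le hp1 hp5 hT.le hK hM
  refine le_of_eq_of_le ?_ key
  simp only [Function.comp_apply, currentS_zero, pot, zero_add]
  refine intervalIntegral.integral_congr fun t _ => integral_congr_ae (ae_of_all _ fun z => ?_)
  simp only
  ring
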